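/- arXiv:2304.03046 — 2 statements merged into one kernel-verified Lean document; each statement's English description precedes it below -/
import Mathlib

section
/- (Erdős–Gallai theorem) Let k ≥ 2 and let G be a simple graph on n vertices. If G contains no subgraph isomorphic to the path P_k on k vertices, then the number of edges of G satisfies e(G) ≤ (k − 2)n/2, with equality if and only if G is a disjoint union of copies of the complete graph K_{k−1}. -/
open SimpleGraph
open scoped Classical

/-- The largest element of the real spectrum of a real matrix (for a real symmetric
matrix this is the largest eigenvalue). -/
noncomputable def specRad {n : ℕ} (M : Matrix (Fin n) (Fin n) ℝ) : ℝ :=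
  sSup (spectrum ℝ M)

/-- The diagonal degree matrix of a simple graph on `Fin n`. -/
noncomputable def degMat {n : ℕ} (G : SimpleGraph (Fin n)) : Matrix (Fin n) (Fin n) ℝ :=
  Matrix.diagonal fun i => (Nat.card {j // G.Adj i j} : ℝ)

/-- The adjacency matrix (over `ℝ`) of a simple graph on `Fin n`. -/
noncomputable def adjMat {n : ℕ} (G : SimpleGraph (Fin n)) : Matrix (Fin n) (Fin n) ℝ :=
  Matrix.of fun i j => if G.Adj i j then (1 : ℝ) else 0

/-- The `A_α`-spectral radius of a graph: largest eigenvalue of `α D + (1-α) A`. -/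
noncomputable def rhoAlpha (α : ℝ) {n : ℕ} (G : SimpleGraph (Fin n)) : ℝ :=
  specRad (α • degMat G + (1 - α) • adjMat G)

/-- The signless Laplacian spectral radius of a graph: largest eigenvalue of `D + A`. -/
noncomputable def qRad {n : ℕ} (G : SimpleGraph (Fin n)) : ℝ :=
  specRad (degMat G + adjMat G)

/-- `G` contains a subgraph isomorphic to the linear forest `⋃ i, P_{k i}`:
there are vertex-disjoint copies of the paths `P_{k i}` in `G`. -/
def ContainsLinearForest {V : Type*} (G : SimpleGraph V) {ℓ : ℕ} (k : Fin ℓ → ℕ) : Prop :=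
  ∃ f : (i : Fin ℓ) → Fin (k i) → V,
    (Function.Injective fun q : (i : Fin ℓ) × Fin (k i) => f q.1 q.2) ∧
    ∀ (i : Fin ℓ) (a b : Fin (k i)),
      (SimpleGraph.pathGraph (k i)).Adj a b → G.Adj (f i a) (f i b)

/-- `G` contains a subgraph isomorphic to `H`. -/
def Contains {V W : Type*} (G : SimpleGraph V) (H : SimpleGraph W) : Prop :=
  ∃ f : W ↪ V, ∀ a b, H.Adj a b → G.Adj (f a) (f b)

/-- `S_{n,p} = K_p ∇ (empty graph on n-p vertices)`, realized on `Fin n` with the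
first `p` vertices forming the dominating clique. -/
def Snp (n p : ℕ) : SimpleGraph (Fin n) :=
  SimpleGraph.fromRel fun i j => i.val < p ∨ j.val < p

/-- `S⁺_{n,p} = K_p ∇ (empty graph on n-p-2 vertices ∪ K_2)`, realized on `Fin n` with the
first `p` vertices forming the dominating clique and the last two vertices adjacent. -/
def SnpPlus (n p : ℕ) : SimpleGraph (Fin n) :=
  SimpleGraph.fromRel fun i j =>
    i.val < p ∨ j.val < p ∨ (n - 2 ≤ i.val ∧ n - 2 ≤ j.val)

/-- `F_{n,p} = K_p ∇ (t K_2 ∪ r K_1)` where `n - p = 2t + r`, `0 ≤ r < 2`, realized on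
`Fin n`: the first `p` vertices form the dominating clique and the remaining vertices
are paired into `t` independent edges (plus possibly one isolated vertex). -/
def Fnp (n p : ℕ) : SimpleGraph (Fin n) :=
  SimpleGraph.fromRel fun i j =>
    i.val < p ∨ j.val < p ∨
      (p ≤ i.val ∧ p ≤ j.val ∧ i.val < p + 2 * ((n - p) / 2) ∧
        j.val < p + 2 * ((n - p) / 2) ∧ (i.val - p) / 2 = (j.val - p) / 2)

/-- The disjoint union of cliques of size `c` on `Fin n` (blocks of consecutive vertices). -/
def unionCliques (n c : ℕ) : SimpleGraph (Fin n) :=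
  SimpleGraph.fromRel fun i j => i.val / c = j.val / c

/-- `K_c ∪ M_{n-c}` on `Fin n`: the first `c` vertices form a clique, the remaining
vertices induce a maximal matching `M_{n-c}` (plus possibly one isolated vertex). -/
def KcupM (n c : ℕ) : SimpleGraph (Fin n) :=
  SimpleGraph.fromRel fun i j =>
    (i.val < c ∧ j.val < c) ∨
      (c ≤ i.val ∧ c ≤ j.val ∧ i.val < c + 2 * ((n - c) / 2) ∧
        j.val < c + 2 * ((n - c) / 2) ∧ (i.val - c) / 2 = (j.val - c) / 2)

/-- The cubic polynomial `f` from the paper. -/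
noncomputable def fpoly (α : ℝ) (n p : ℕ) (x : ℝ) : ℝ :=
  x ^ 3 - ((p : ℝ) + (n : ℝ) * α + (p : ℝ) * α) * x ^ 2 +
    ((p : ℝ) - (n : ℝ) * (p : ℝ) + (n : ℝ) * α - 2 * (p : ℝ) * α + (p : ℝ) ^ 2 +
      (n : ℝ) * (p : ℝ) * α ^ 2 + 2 * (n : ℝ) * (p : ℝ) * α - 1) * x +
    (p : ℝ) ^ 2 * α ^ 2 - 2 * (p : ℝ) + (p : ℝ) ^ 3 * α ^ 2 + (n : ℝ) * (p : ℝ) +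
    5 * (p : ℝ) * α - 2 * α ^ 2 + (p : ℝ) ^ 2 * α - (p : ℝ) ^ 3 * α - (p : ℝ) ^ 2 +
    (n : ℝ) * (p : ℝ) ^ 2 * α - 2 * (n : ℝ) * (p : ℝ) ^ 2 * α ^ 2 -
    2 * (n : ℝ) * (p : ℝ) * α

/-- The cubic polynomial `g` from the paper. -/
noncomputable def gpoly (n p : ℕ) (x : ℝ) : ℝ :=
  x ^ 3 - ((n : ℝ) + 3 * (p : ℝ)) * x ^ 2 +
    (4 * (p : ℝ) ^ 2 + (n : ℝ) * (p : ℝ) + 2 * (n : ℝ) - 4) * x -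
    2 * (p : ℝ) ^ 2 * ((p : ℝ) + 1)

namespace SimpleGraph

variable {V : Type*} (G : SimpleGraph V)

/-- The list `L` traces a path of `G` all of whose vertices lie in `S`. -/
structure IsPathListIn (S : Finset V) (L : List V) : Prop where
  isChain : L.IsChain G.Adj
  nodup : L.Nodup
  mem : ∀ x ∈ L, x ∈ S

variable [DecidableEq V] [DecidableRel G.Adj]

/-- The number of neighbours of `v` inside `S`. -/
def degreeIn (S : Finset V) (v : V) : ℕ := (S.filter (G.Adj v)).card

/-- The sum over `S` of the degrees in the subgraph induced on `S`. -/
def degreeSumIn (S : Finset V) : ℕ := ∑ v ∈ S, G.degreeIn S v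

/-- The subgraph induced on `S` is a disjoint union of cliques of order `d`. -/
def IsCliqueUnionOn (d : ℕ) (S : Finset V) : Prop :=
  ∀ u ∈ S, ∃ C ⊆ S, u ∈ C ∧ G.IsNClique d C ∧ ∀ x ∈ C, ∀ y ∈ S, G.Adj x y → y ∈ C

variable {G}

theorem degreeSumIn_insert {S : Finset V} {v : V} (hv : v ∉ S) :
    G.degreeSumIn (insert v S) = G.degreeSumIn S + 2 * G.degreeIn S v := by
  have h1 : G.degreeIn (insert v S) v = G.degreeIn S v := by
    simp [degreeIn, Finset.filter_insert]
  have h2 : ∀ u ∈ S, G.degreeIn (insert v S) u = G.degreeIn S u + if G.Adj v u then 1 else 0 := by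
    intro u hu
    by_cases h : G.Adj v u
    · simp [degreeIn, Finset.filter_insert, h, h.symm, hv]
    · have h' : ¬ G.Adj u v := fun h' => h h'.symm
      simp [degreeIn, Finset.filter_insert, h, h']
  rw [degreeSumIn, Finset.sum_insert hv, h1, Finset.sum_congr rfl h2, Finset.sum_add_distrib,
    ← Finset.card_filter]
  simp only [degreeSumIn, degreeIn]
  ring

theorem degreeSumIn_eq_add_of_closed {S C : Finset V} (hCS : C ⊆ S)
    (hC : ∀ x ∈ C, ∀ y ∈ S, G.Adj x y → y ∈ C) :
    G.degreeSumIn S = G.degreeSumIn (S \ C) + G.degreeSumIn C := by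
  rw [degreeSumIn, ← Finset.sum_sdiff hCS]
  congr 1
  · refine Finset.sum_congr rfl fun u hu => ?_
    rw [Finset.mem_sdiff] at hu
    unfold degreeIn
    congr 1
    ext y
    simp only [Finset.mem_filter, Finset.mem_sdiff]
    exact ⟨fun h => ⟨⟨h.1, fun hy => hu.2 (hC y hy u hu.1 h.2.symm)⟩, h.2⟩,
      fun h => ⟨h.1.1, h.2⟩⟩
  · refine Finset.sum_congr rfl fun u hu => ?_
    unfold degreeIn
    congr 1
    ext y
    simp only [Finset.mem_filter]
    exact ⟨fun h => ⟨hC u hu y h.1 h.2, h.2⟩, fun h => ⟨hCS h.1, h.2⟩⟩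

theorem degreeIn_le_card_sub_one {C : Finset V} {u : V} (hu : u ∈ C) :
    G.degreeIn C u ≤ C.card - 1 := by
  rw [← Finset.card_erase_of_mem hu]
  refine Finset.card_le_card fun y hy => ?_
  rw [Finset.mem_filter] at hy
  exact Finset.mem_erase.2 ⟨hy.2.ne', hy.1⟩

theorem degreeSumIn_le (C : Finset V) : G.degreeSumIn C ≤ C.card * (C.card - 1) := by
  rw [← smul_eq_mul]
  exact Finset.sum_le_card_nsmul _ _ _ fun u hu => degreeIn_le_card_sub_one hu

theorem isClique_of_degreeSumIn_eq {C : Finset V}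
    (h : G.degreeSumIn C = C.card * (C.card - 1)) : G.IsClique (C : Set V) := by
  have h' : ∀ u ∈ C, G.degreeIn C u = C.card - 1 := by
    refine (Finset.sum_eq_sum_iff_of_le fun u hu => degreeIn_le_card_sub_one hu).1 ?_
    simpa [degreeSumIn] using h
  intro u hu y hy hne
  have hsub : C.filter (G.Adj u) ⊆ C.erase u := fun z hz => by
    rw [Finset.mem_filter] at hz
    exact Finset.mem_erase.2 ⟨hz.2.ne', hz.1⟩
  have heq := Finset.eq_of_subset_of_card_le hsub
    (by rw [Finset.card_erase_of_mem hu]; exact (h' u hu).ge)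
  have : y ∈ C.filter (G.Adj u) := by
    rw [heq]
    exact Finset.mem_erase.2 ⟨hne.symm, hy⟩
  exact (Finset.mem_filter.1 this).2

omit [DecidableEq V] [DecidableRel G.Adj] in
theorem IsPathListIn.reverse {S : Finset V} {L : List V} (h : G.IsPathListIn S L) :
    G.IsPathListIn S L.reverse := by
  refine ⟨?_, List.nodup_reverse.2 h.nodup, fun x hx => h.mem x (List.mem_reverse.1 hx)⟩
  rw [List.isChain_reverse]
  exact h.isChain.imp fun _ _ hab => hab.symm

omit [DecidableEq V] [DecidableRel G.Adj] in
theorem exists_longest_isPathListIn {S : Finset V} {d : ℕ} (hS : S.Nonempty)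
    (hbound : ∀ L, G.IsPathListIn S L → L.length ≤ d) :
    ∃ L, L ≠ [] ∧ G.IsPathListIn S L ∧ ∀ L', G.IsPathListIn S L' → L'.length ≤ L.length := by
  obtain ⟨v, hv⟩ := hS
  have hsing : G.IsPathListIn S [v] := ⟨by simp, by simp, by simpa using hv⟩
  have hfin : (List.length '' {L | G.IsPathListIn S L}).Finite :=
    (Set.finite_Iic d).subset (by rintro _ ⟨L, hL, rfl⟩; exact hbound L hL)
  obtain ⟨m, ⟨L, hL, rfl⟩, hm⟩ := Set.exists_max_image _ id hfin ⟨_, [v], hsing, rfl⟩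
  have hmax : ∀ L', G.IsPathListIn S L' → L'.length ≤ L.length := fun L' hL' => hm _ ⟨L', hL', rfl⟩
  refine ⟨L, ?_, hL, hmax⟩
  rintro rfl
  simpa using hmax _ hsing

omit [DecidableEq V] [DecidableRel G.Adj] in
theorem IsPathListIn.mem_of_adj_head {S : Finset V} {a y : V} {L : List V}
    (h : G.IsPathListIn S (a :: L))
    (hmax : ∀ L', G.IsPathListIn S L' → L'.length ≤ (a :: L).length)
    (hy : y ∈ S) (hay : G.Adj a y) : y ∈ a :: L := by
  by_contra hyL
  have := hmax (y :: a :: L) ⟨List.isChain_cons_cons.2 ⟨hay.symm, h.isChain⟩,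
    List.nodup_cons.2 ⟨hyL, h.nodup⟩, by
      intro x hx
      rcases List.mem_cons.1 hx with rfl | hx
      exacts [hy, h.mem x hx]⟩
  simp at this

/-- If the end degrees of a longest path add up to at least its order, the vertices of
the path can be rearranged into a cyclic list. -/
theorem IsPathListIn.exists_cyclic {S : Finset V} {L : List V} (hne : L ≠ [])
    (h : G.IsPathListIn S L) (hmax : ∀ L', G.IsPathListIn S L' → L'.length ≤ L.length)
    (hdeg : L.length ≤ G.degreeIn S (L.head hne) + G.degreeIn S (L.getLast hne)) :
    ∃ M : List V, M.Perm L ∧ M.IsChain G.Adj ∧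
      ∀ x ∈ M.getLast?, ∀ y ∈ M.head?, G.Adj x y := by
  set a := L.head hne with ha
  set b := L.getLast hne with hb
  have hpos : 0 < L.length := List.length_pos_iff.2 hne
  have hnbr_head : ∀ y ∈ S, G.Adj a y → y ∈ L := by
    intro y hy hay
    obtain ⟨c, L, rfl⟩ := List.exists_cons_of_ne_nil hne
    exact h.mem_of_adj_head hmax hy hay
  have hnbr_last : ∀ y ∈ S, G.Adj b y → y ∈ L := by
    intro y hy hby
    rw [← List.mem_reverse]
    have hrev := h.reverse
    have hb' : b = L.reverse.head (by simpa using hne) := by simp [hb]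
    rw [← List.length_reverse] at hmax
    obtain ⟨c, L', hL'⟩ := List.exists_cons_of_ne_nil (l := L.reverse) (by simpa using hne)
    simp only [hL', List.head_cons] at hb' hrev hmax ⊢
    subst hb'
    exact hrev.mem_of_adj_head hmax hy hby
  let A := (Finset.range (L.length - 1)).filter fun i => G.Adj a (L.getD (i + 1) a)
  let B := (Finset.range (L.length - 1)).filter fun i => G.Adj b (L.getD i a)
  have hA : G.degreeIn S a ≤ A.card := by
    refine le_trans (Finset.card_le_card ?_)
      (Finset.card_image_le (s := A) (f := fun i => L.getD (i + 1) a))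
    intro y hy
    rw [Finset.mem_filter] at hy
    obtain ⟨j, hj, rfl⟩ := List.mem_iff_getElem.1 (hnbr_head y hy.1 hy.2)
    have hj0 : j ≠ 0 := by
      rintro rfl
      exact hy.2.ne (by rw [ha, List.head_eq_getElem])
    obtain ⟨i, rfl⟩ := Nat.exists_eq_succ_of_ne_zero hj0
    have hget : L.getD (i + 1) a = L[i + 1] := List.getD_eq_getElem _ _ hj
    refine Finset.mem_image.2 ⟨i, Finset.mem_filter.2 ⟨Finset.mem_range.2 (by omega), ?_⟩, hget⟩
    rw [hget]
    exact hy.2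
  have hB : G.degreeIn S b ≤ B.card := by
    refine le_trans (Finset.card_le_card ?_)
      (Finset.card_image_le (s := B) (f := fun i => L.getD i a))
    intro y hy
    rw [Finset.mem_filter] at hy
    obtain ⟨i, hi, rfl⟩ := List.mem_iff_getElem.1 (hnbr_last y hy.1 hy.2)
    have hi0 : i ≠ L.length - 1 := by
      rintro rfl
      exact hy.2.ne (by rw [hb, List.getLast_eq_getElem])
    have hget : L.getD i a = L[i] := List.getD_eq_getElem _ _ hi
    refine Finset.mem_image.2 ⟨i, Finset.mem_filter.2 ⟨Finset.mem_range.2 (by omega), ?_⟩, hget⟩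
    rw [hget]
    exact hy.2
  have hAB : ¬ Disjoint A B := by
    intro hdisj
    have h1 : (A ∪ B).card ≤ L.length - 1 := by
      rw [← Finset.card_range (L.length - 1)]
      exact Finset.card_le_card
        (Finset.union_subset (Finset.filter_subset _ _) (Finset.filter_subset _ _))
    rw [Finset.card_union_of_disjoint hdisj] at h1
    omega
  obtain ⟨i, hiA, hiB⟩ := Finset.not_disjoint_iff.1 hAB
  rw [Finset.mem_filter, Finset.mem_range] at hiA hiB
  obtain ⟨hi, hai⟩ := hiA
  have hbi := hiB.2
  rw [List.getD_eq_getElem _ _ (by omega)] at hai hbi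
  have hsplit : L.take (i + 1) ++ L.drop (i + 1) = L := List.take_append_drop _ _
  have hchain := h.isChain
  rw [← hsplit, List.isChain_append] at hchain
  have hhead : (L.take (i + 1)).head? = some a := by
    rw [List.head?_take, if_neg (by omega), ha, List.head?_eq_some_head hne]
  have hlast : (L.take (i + 1)).getLast? = some L[i] := by
    rw [List.getLast?_take]
    simp [List.getElem?_eq_getElem (show i < L.length by omega)]
  have hhead' : (L.drop (i + 1)).head? = some L[i + 1] := by
    rw [List.head?_drop, List.getElem?_eq_getElem (by omega)]
  have hlast' : (L.drop (i + 1)).getLast? = some b := by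
    rw [List.getLast?_drop, if_neg (by omega), hb, List.getLast?_eq_some_getLast hne]
  refine ⟨(L.take (i + 1)).reverse ++ L.drop (i + 1), ?_, ?_, ?_⟩
  · exact ((List.reverse_perm _).append_right _).trans (List.Perm.of_eq hsplit)
  · refine List.isChain_append.2 ⟨?_, hchain.2.1, ?_⟩
    · rw [List.isChain_reverse]
      exact hchain.1.imp fun _ _ hab => hab.symm
    · intro x hx y hy
      rw [List.getLast?_reverse, hhead] at hx
      rw [hhead'] at hy
      simp only [Option.mem_def, Option.some.injEq] at hx hy
      subst hx hy
      exact hai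
  · intro x hx y hy
    rw [List.getLast?_append, hlast'] at hx
    rw [List.head?_append, List.head?_reverse, hlast] at hy
    simp at hx hy
    subst hx hy
    exact hbi

omit [DecidableEq V] [DecidableRel G.Adj] in
theorem mem_of_adj_of_cyclic {S : Finset V} {M : List V} (h : G.IsPathListIn S M)
    (hmax : ∀ L', G.IsPathListIn S L' → L'.length ≤ M.length)
    (hcyc : ∀ x ∈ M.getLast?, ∀ y ∈ M.head?, G.Adj x y)
    {x y : V} (hx : x ∈ M) (hy : y ∈ S) (hxy : G.Adj x y) : y ∈ M := by
  obtain ⟨P, Q, rfl⟩ := List.append_of_mem hx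
  have hperm : (x :: Q ++ P).Perm (P ++ x :: Q) := List.perm_append_comm
  have hchain := List.isChain_append.1 h.isChain
  have hrot : G.IsPathListIn S (x :: (Q ++ P)) := by
    refine ⟨List.isChain_append.2 ⟨hchain.2.1, hchain.1, ?_⟩, hperm.nodup_iff.2 h.nodup,
      fun z hz => h.mem z (hperm.mem_iff.1 hz)⟩
    intro u hu w hw
    refine hcyc u ?_ w ?_
    · rw [List.getLast?_append, hu]; rfl
    · rw [List.head?_append, hw]; rfl
  refine hperm.mem_iff.1 (hrot.mem_of_adj_head (fun L' hL' => ?_) hy hxy)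
  exact (hmax L' hL').trans hperm.length_eq.ge

omit [DecidableRel G.Adj] in
/-- A disjoint union of cliques of order `d` has no edge to an outside vertex when all
paths have at most `d` vertices. -/
theorem IsCliqueUnionOn.not_adj {S : Finset V} {d : ℕ} (hS : G.IsCliqueUnionOn d S) {u v : V}
    (hu : u ∈ S) (hv : v ∉ S)
    (hbound : ∀ L, G.IsPathListIn (insert v S) L → L.length ≤ d) : ¬ G.Adj v u := by
  intro hvu
  obtain ⟨C, hCS, huC, hC, -⟩ := hS u hu
  have hnodup : (u :: (C.erase u).toList).Nodup := by simp [Finset.nodup_toList]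
  have hmem : ∀ x ∈ u :: (C.erase u).toList, x ∈ C := by
    intro x hx
    rcases List.mem_cons.1 hx with rfl | hx
    · exact huC
    · exact Finset.mem_of_mem_erase (Finset.mem_toList.1 hx)
  have hchain : (u :: (C.erase u).toList).IsChain G.Adj := by
    refine List.Pairwise.isChain (hnodup.imp_of_mem fun ha hb hne => ?_)
    exact hC.isClique (hmem _ ha) (hmem _ hb) hne
  have := hbound (v :: u :: (C.erase u).toList)
    ⟨List.isChain_cons_cons.2 ⟨hvu, hchain⟩,
      List.nodup_cons.2 ⟨fun hmv => hv (hCS (hmem _ hmv)), hnodup⟩, by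
      intro x hx
      rcases List.mem_cons.1 hx with rfl | hx
      · exact Finset.mem_insert_self _ _
      · exact Finset.mem_insert_of_mem (hCS (hmem x hx))⟩
  have hcard := Finset.card_erase_add_one huC
  simp only [List.length_cons, Finset.length_toList, hC.card_eq] at this hcard
  omega

omit [DecidableRel G.Adj] in
theorem IsCliqueUnionOn.of_sdiff {S C : Finset V} {d : ℕ} (hCS : C ⊆ S) (hC : G.IsNClique d C)
    (hclosed : ∀ x ∈ C, ∀ y ∈ S, G.Adj x y → y ∈ C) (h : G.IsCliqueUnionOn d (S \ C)) :
    G.IsCliqueUnionOn d S := by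
  intro u hu
  by_cases huC : u ∈ C
  · exact ⟨C, hCS, huC, hC, hclosed⟩
  · obtain ⟨D, hD, huD, hDc, hDclosed⟩ := h u (Finset.mem_sdiff.2 ⟨hu, huC⟩)
    refine ⟨D, hD.trans Finset.sdiff_subset, huD, hDc, fun x hx y hy hxy => ?_⟩
    have hxS := Finset.mem_sdiff.1 (hD hx)
    exact hDclosed x hx y
      (Finset.mem_sdiff.2 ⟨hy, fun hyC => hxS.2 (hclosed y hyC x hxS.1 hxy.symm)⟩) hxy

theorem exists_closed_of_lt_degreeIn {S : Finset V} {c : ℕ} (hS : S.Nonempty)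
    (hbound : ∀ L, G.IsPathListIn S L → L.length ≤ c + 1)
    (hdeg : ∀ v ∈ S, c < 2 * G.degreeIn S v) :
    ∃ C ⊆ S, C.Nonempty ∧ C.card ≤ c + 1 ∧ ∀ x ∈ C, ∀ y ∈ S, G.Adj x y → y ∈ C := by
  obtain ⟨L, hne, hL, hmax⟩ := exists_longest_isPathListIn hS hbound
  have h1 := hdeg _ (hL.mem _ (List.head_mem hne))
  have h2 := hdeg _ (hL.mem _ (List.getLast_mem hne))
  have h3 := hbound L hL
  obtain ⟨M, hperm, hchain, hcyc⟩ := hL.exists_cyclic hne hmax (by omega)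
  have hM : G.IsPathListIn S M :=
    ⟨hchain, hperm.nodup_iff.2 hL.nodup, fun x hx => hL.mem x (hperm.mem_iff.1 hx)⟩
  refine ⟨M.toFinset, fun x hx => hM.mem x (List.mem_toFinset.1 hx), ?_, ?_, ?_⟩
  · rw [List.toFinset_nonempty_iff]
    rintro rfl
    exact hne (List.nil_perm.1 hperm)
  · exact (List.toFinset_card_le M).trans (hbound M hM)
  · intro x hx y hy hxy
    rw [List.mem_toFinset] at hx ⊢
    exact mem_of_adj_of_cyclic hM (fun L' hL' => (hmax L' hL').trans hperm.length_eq.ge)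
      hcyc hx hy hxy

variable (G) in
theorem degreeSumIn_le_and_isCliqueUnionOn {c : ℕ} (S : Finset V)
    (hbound : ∀ L, G.IsPathListIn S L → L.length ≤ c + 1) :
    G.degreeSumIn S ≤ c * S.card ∧
      (G.degreeSumIn S = c * S.card → G.IsCliqueUnionOn (c + 1) S) := by
  induction S using Finset.strongInduction with
  | H S ih =>
  have hmono : ∀ T ⊆ S, ∀ L, G.IsPathListIn T L → L.length ≤ c + 1 := fun T hT L hL =>
    hbound L ⟨hL.isChain, hL.nodup, fun x hx => hT (hL.mem x hx)⟩
  rcases S.eq_empty_or_nonempty with rfl | hS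
  · exact ⟨by simp [degreeSumIn], fun _ u hu => by simp at hu⟩
  by_cases hdeg : ∃ v ∈ S, 2 * G.degreeIn S v ≤ c
  · obtain ⟨v, hv, hvdeg⟩ := hdeg
    obtain ⟨T, hvT, rfl⟩ : ∃ T, v ∉ T ∧ insert v T = S :=
      ⟨S.erase v, Finset.notMem_erase v S, Finset.insert_erase hv⟩
    have hsub : T ⊂ insert v T := Finset.ssubset_insert hvT
    obtain ⟨hle, heq⟩ := ih T hsub (hmono T hsub.subset)
    have hdegT : G.degreeIn (insert v T) v = G.degreeIn T v := by
      simp [degreeIn, Finset.filter_insert]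
    rw [degreeSumIn_insert hvT, Finset.card_insert_of_notMem hvT, mul_add_one]
    refine ⟨by omega, fun h => ?_⟩
    have hT := heq (by omega)
    have hisolated : ∀ u ∈ T, ¬ G.Adj v u := fun u hu => hT.not_adj hu hvT hbound
    have hzero : G.degreeIn T v = 0 := by
      rw [degreeIn, Finset.card_eq_zero, Finset.filter_eq_empty_iff]
      exact fun u hu => hisolated u hu
    have hc : c = 0 := by omega
    subst hc
    refine .of_sdiff (C := {v}) (by simp) (by simp [isNClique_iff]) ?_ ?_
    · intro x hx y hy hxy
      rw [Finset.mem_singleton] at hx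
      subst hx
      rcases Finset.mem_insert.1 hy with rfl | hy
      exacts [(hxy.ne rfl).elim, (hisolated y hy hxy).elim]
    · rwa [Finset.insert_sdiff_of_mem _ (Finset.mem_singleton_self v),
        Finset.sdiff_singleton_eq_erase, Finset.erase_eq_of_notMem hvT]
  · push Not at hdeg
    obtain ⟨C, hCS, hCne, hCcard, hclosed⟩ := exists_closed_of_lt_degreeIn hS hbound hdeg
    have hsub : S \ C ⊂ S := Finset.sdiff_ssubset hCS hCne
    obtain ⟨hle, heq⟩ := ih _ hsub (hmono _ hsub.subset)
    have hsum := degreeSumIn_eq_add_of_closed hCS hclosed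
    have hcard := Finset.card_sdiff_add_card_eq_card hCS
    have hC_le := degreeSumIn_le (G := G) C
    have hCpos := hCne.card_pos
    have hmul : C.card * (C.card - 1) ≤ c * C.card := by
      rw [mul_comm]
      exact Nat.mul_le_mul_right _ (by omega)
    have htot : c * S.card = c * (S \ C).card + c * C.card := by rw [← hcard, mul_add]
    refine ⟨by omega, fun h => ?_⟩
    have hCeq : G.degreeSumIn C = C.card * (C.card - 1) := by omega
    have hm : (C.card - 1) * C.card = c * C.card := by rw [mul_comm]; omega
    have hc : C.card - 1 = c := Nat.eq_of_mul_eq_mul_right hCpos hm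
    exact .of_sdiff hCS ⟨isClique_of_degreeSumIn_eq hCeq, by omega⟩ hclosed (heq (by omega))

omit [DecidableRel G.Adj] in
theorem IsCliqueUnionOn.sdiff {S C : Finset V} {d : ℕ} (h : G.IsCliqueUnionOn d S)
    (hclosed : ∀ x ∈ C, ∀ y ∈ S, G.Adj x y → y ∈ C) : G.IsCliqueUnionOn d (S \ C) := by
  intro u hu
  rw [Finset.mem_sdiff] at hu
  obtain ⟨D, hDS, huD, hD, hDclosed⟩ := h u hu.1
  refine ⟨D, fun x hx => Finset.mem_sdiff.2 ⟨hDS hx, fun hxC => ?_⟩, huD, hD,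
    fun x hx y hy => hDclosed x hx y (Finset.mem_sdiff.1 hy).1⟩
  by_cases hxu : x = u
  · exact hu.2 (hxu ▸ hxC)
  · exact hu.2 (hclosed x hxC u hu.1 (hD.isClique hx huD hxu))

omit [DecidableRel G.Adj] in
/-- A disjoint union of cliques of order `d` can be numbered so that the cliques are the
blocks of `d` consecutive numbers. -/
theorem IsCliqueUnionOn.exists_numbering {d : ℕ} (hd : 0 < d) (S : Finset V)
    (hS : G.IsCliqueUnionOn d S) :
    d ∣ S.card ∧ ∃ f : V → ℕ, Set.InjOn f S ∧ (∀ v ∈ S, f v < S.card) ∧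
      ∀ u ∈ S, ∀ v ∈ S, G.Adj u v ↔ u ≠ v ∧ f u / d = f v / d := by
  induction S using Finset.strongInduction with
  | H S ih =>
  rcases S.eq_empty_or_nonempty with rfl | ⟨w, hw⟩
  · exact ⟨by simp, fun _ => 0, by simp, by simp, by simp⟩
  obtain ⟨C, hCS, hwC, hC, hclosed⟩ := hS w hw
  have hcard := Finset.card_sdiff_add_card_eq_card hCS
  obtain ⟨⟨q, hq⟩, f, hinj, hlt, hadj⟩ :=
    ih _ (Finset.sdiff_ssubset hCS ⟨w, hwC⟩) (hS.sdiff hclosed)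
  rw [hC.card_eq, hq] at hcard
  refine ⟨⟨q + 1, by rw [← hcard]; ring⟩, ?_⟩
  let g : V → ℕ := fun v => if h : v ∈ C then d * q + C.equivFin ⟨v, h⟩ else f v
  have hgC : ∀ v, ∀ h : v ∈ C, g v = d * q + C.equivFin ⟨v, h⟩ := fun v h => dif_pos h
  have hgf : ∀ v, v ∉ C → g v = f v := fun v h => dif_neg h
  have hidx : ∀ v, ∀ h : v ∈ C, (C.equivFin ⟨v, h⟩ : ℕ) < d := fun v h =>
    (C.equivFin ⟨v, h⟩).isLt.trans_eq hC.card_eq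
  have hflt : ∀ v ∈ S, v ∉ C → f v < d * q := fun v hv h => by
    rw [← hq]
    exact hlt v (Finset.mem_sdiff.2 ⟨hv, h⟩)
  have hdivC : ∀ v ∈ C, g v / d = q := fun v h => by
    rw [hgC v h, Nat.mul_add_div hd, Nat.div_eq_of_lt (hidx v h), add_zero]
  have hdivf : ∀ v ∈ S, v ∉ C → g v / d < q := fun v hv h => by
    rw [hgf v h]
    exact Nat.div_lt_of_lt_mul (hflt v hv h)
  refine ⟨g, ?_, ?_, ?_⟩
  · intro u hu v hv huv
    by_cases huC : u ∈ C <;> by_cases hvC : v ∈ C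
    · rw [hgC u huC, hgC v hvC, Nat.add_left_cancel_iff, Fin.val_inj,
        EmbeddingLike.apply_eq_iff_eq] at huv
      exact congrArg Subtype.val huv
    · exact absurd (hdivf v hv hvC) (by rw [← huv, hdivC u huC]; exact lt_irrefl q)
    · exact absurd (hdivf u hu huC) (by rw [huv, hdivC v hvC]; exact lt_irrefl q)
    · rw [hgf u huC, hgf v hvC] at huv
      exact hinj (Finset.mem_sdiff.2 ⟨hu, huC⟩) (Finset.mem_sdiff.2 ⟨hv, hvC⟩) huv
  · intro v hv
    by_cases hvC : v ∈ C
    · have := hidx v hvC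
      rw [hgC v hvC]
      omega
    · have := hflt v hv hvC
      rw [hgf v hvC]
      omega
  · intro u hu v hv
    by_cases huC : u ∈ C <;> by_cases hvC : v ∈ C
    · rw [hdivC u huC, hdivC v hvC]
      exact ⟨fun h => ⟨h.ne, rfl⟩, fun h => hC.isClique huC hvC h.1⟩
    · have := hdivf v hv hvC
      rw [hdivC u huC]
      exact ⟨fun h => absurd (hclosed u huC v hv h) hvC, fun h => by omega⟩
    · have := hdivf u hu huC
      rw [hdivC v hvC]
      exact ⟨fun h => absurd (hclosed v hvC u hu h.symm) huC, fun h => by omega⟩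
    · rw [hgf u huC, hgf v hvC]
      exact hadj u (Finset.mem_sdiff.2 ⟨hu, huC⟩) v (Finset.mem_sdiff.2 ⟨hv, hvC⟩)

omit [DecidableEq V] in
theorem degreeSumIn_univ [Fintype V] :
    G.degreeSumIn Finset.univ = 2 * Nat.card G.edgeSet := by
  rw [Nat.card_eq_fintype_card, ← edgeFinset_card, ← sum_degrees_eq_twice_card_edges]
  refine Finset.sum_congr rfl fun v _ => ?_
  rw [degreeIn, ← card_neighborFinset_eq_degree, neighborFinset_eq_filter]

end SimpleGraph

theorem length_lt_of_not_contains_pathGraph {V : Type*} {G : SimpleGraph V} {k : ℕ}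
    (hfree : ¬ Contains G (pathGraph k)) {L : List V} (hchain : L.IsChain G.Adj)
    (hnodup : L.Nodup) : L.length < k := by
  by_contra! hlen
  refine hfree ⟨⟨fun i => L[i.val], fun i j hij => ?_⟩, fun i j hij => ?_⟩
  · exact Fin.ext ((hnodup.getElem_inj_iff).1 hij)
  · rw [List.isChain_iff_getElem] at hchain
    change G.Adj L[i.val] L[j.val]
    rcases pathGraph_adj.1 hij with h | h
    · simpa only [h] using hchain i.val (by omega)
    · simpa only [h] using (hchain j.val (by omega)).symm

theorem unionCliques_adj {n d : ℕ} {i j : Fin n} :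
    (unionCliques n d).Adj i j ↔ i ≠ j ∧ i.val / d = j.val / d := by
  rw [unionCliques, fromRel_adj, eq_comm (a := j.val / d), or_self]

theorem degreeIn_univ_unionCliques {n d : ℕ} (hd : 0 < d) (hdn : d ∣ n) (i : Fin n) :
    (unionCliques n d).degreeIn Finset.univ i = d - 1 := by
  obtain ⟨m, rfl⟩ := hdn
  have hq : i.val / d < m := Nat.div_lt_of_lt_mul i.isLt
  have hmul : d * (i.val / d) + d ≤ d * m := by
    rw [← Nat.mul_succ]
    exact Nat.mul_le_mul_left d hq
  have hset : (Finset.univ.filter ((unionCliques (d * m) d).Adj i)).map Fin.valEmbedding =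
      (Finset.Ico (d * (i.val / d)) (d * (i.val / d) + d)).erase i.val := by
    ext x
    have hx : x / d = i.val / d ↔ d * (i.val / d) ≤ x ∧ x < d * (i.val / d) + d := by
      rw [Nat.div_eq_iff hd, mul_comm]
      omega
    simp only [Finset.mem_map, Finset.mem_filter, Finset.mem_univ, true_and, unionCliques_adj,
      Fin.valEmbedding_apply, Finset.mem_erase, Finset.mem_Ico, ← hx]
    constructor
    · rintro ⟨j, ⟨hne, h⟩, rfl⟩
      exact ⟨fun h' => hne (Fin.ext h'.symm), h.symm⟩
    · rintro ⟨hne, h⟩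
      exact ⟨⟨x, by have := hx.1 h; omega⟩, ⟨fun h' => hne (by rw [h']), h.symm⟩, rfl⟩
  rw [degreeIn, ← Finset.card_map Fin.valEmbedding, hset, Finset.card_erase_of_mem]
  · simp
  · have h1 := Nat.mul_div_le i.val d
    have h2 := Nat.lt_mul_div_succ i.val hd
    rw [mul_add_one] at h2
    exact Finset.mem_Ico.2 ⟨h1, h2⟩

theorem two_mul_card_edgeSet_unionCliques {n d : ℕ} (hd : 0 < d) (hdn : d ∣ n) :
    2 * Nat.card (unionCliques n d).edgeSet = (d - 1) * n := by
  rw [← degreeSumIn_univ, degreeSumIn,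
    Finset.sum_congr rfl fun i _ => degreeIn_univ_unionCliques hd hdn i]
  simp [mul_comm]

theorem nonempty_iso_unionCliques {n d : ℕ} (hd : 0 < d) {G : SimpleGraph (Fin n)}
    (h : G.IsCliqueUnionOn d Finset.univ) : d ∣ n ∧ Nonempty (G ≃g unionCliques n d) := by
  obtain ⟨hdvd, f, hinj, hlt, hadj⟩ := h.exists_numbering hd
  simp only [Finset.card_univ, Fintype.card_fin, Finset.mem_univ, forall_const] at hdvd hlt hadj
  have hbij : Function.Bijective fun v => (⟨f v, hlt v⟩ : Fin n) :=
    Finite.injective_iff_bijective.1 fun u v huv =>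
      hinj (by simp) (by simp) (congrArg Fin.val huv)
  refine ⟨hdvd, ⟨⟨Equiv.ofBijective _ hbij, fun {u v} => ?_⟩⟩⟩
  simp only [Equiv.ofBijective_apply, unionCliques_adj, hadj, ne_eq, hbij.1.eq_iff]

theorem erdos_gallai (k : ℕ) (hk : 2 ≤ k) (n : ℕ) (G : SimpleGraph (Fin n))
    (hfree : ¬ Contains G (SimpleGraph.pathGraph k)) :
    2 * Nat.card G.edgeSet ≤ (k - 2) * n ∧
    (2 * Nat.card G.edgeSet = (k - 2) * n ↔
      (k - 1) ∣ n ∧ Nonempty (G ≃g unionCliques n (k - 1))) := by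
  obtain ⟨c, rfl⟩ := Nat.exists_eq_add_of_le' hk
  obtain ⟨hle, heq⟩ := G.degreeSumIn_le_and_isCliqueUnionOn (c := c) Finset.univ fun L hL =>
    Nat.le_of_lt_succ (length_lt_of_not_contains_pathGraph hfree hL.isChain hL.nodup)
  rw [degreeSumIn_univ, Finset.card_univ, Fintype.card_fin] at hle heq
  refine ⟨hle, fun h => nonempty_iso_unionCliques (Nat.succ_pos c) (heq h), ?_⟩
  rintro ⟨hdvd, ⟨e⟩⟩
  rw [Nat.card_congr e.mapEdgeSet]
  exact two_mul_card_edgeSet_unionCliques (Nat.succ_pos c) hdvd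
end

section
/- Let F_ℓ = P_{k_1} ∪ ⋯ ∪ P_{k_ℓ} be a linear forest with ℓ ≥ 2, k_1 ≥ ⋯ ≥ k_ℓ ≥ 2, p = (∑_{i=1}^{ℓ} ⌊k_i/2⌋) − 1, and suppose at least one k_i is not equal to 3. Set c = 1 if all k_i are odd and c = 0 otherwise. Then there exists N such that for all n ≥ N, every F_ℓ-free simple graph G on n vertices satisfies e(G) ≤ C(p,2) + p(n − p) + c; moreover, if c = 1 then equality holds if and only if G is isomorphic to S⁺_{n,p}, and if c = 0 then equality holds if and only if G is isomorphic to S_{n,p}. -/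
open SimpleGraph
open scoped Classical

namespace LinearForest

variable {V : Type*}

/-! ### Paths as lists of vertices -/

/-- A list of vertices that traces a path of `G`. -/
def IsPathList (G : SimpleGraph V) (L : List V) : Prop :=
  L.IsChain G.Adj ∧ L.Nodup

theorem IsPathList.singleton (G : SimpleGraph V) (a : V) : IsPathList G [a] :=
  ⟨List.isChain_singleton a, List.nodup_singleton a⟩

theorem IsPathList.take {G : SimpleGraph V} {L : List V} (h : IsPathList G L) (m : ℕ) :
    IsPathList G (L.take m) :=
  ⟨h.1.take m, h.2.sublist (List.take_sublist m L)⟩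

theorem IsPathList.reverse {G : SimpleGraph V} {L : List V} (h : IsPathList G L) :
    IsPathList G L.reverse := by
  refine ⟨?_, List.nodup_reverse.2 h.2⟩
  rw [List.isChain_reverse]
  exact h.1.imp fun _ _ hab => hab.symm

theorem IsPathList.append {G : SimpleGraph V} {L L' : List V} (h : IsPathList G L)
    (h' : IsPathList G L') (hd : ∀ v ∈ L, v ∉ L')
    (hadj : ∀ x ∈ L.getLast?, ∀ y ∈ L'.head?, G.Adj x y) : IsPathList G (L ++ L') :=
  ⟨List.isChain_append.2 ⟨h.1, h'.1, hadj⟩,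
    List.nodup_append.2 ⟨h.2, h'.2, fun a ha _ hb hab => hd a ha (hab ▸ hb)⟩⟩

theorem IsPathList.cons {G : SimpleGraph V} {a : V} {L : List V} (h : IsPathList G L)
    (ha : a ∉ L) (hadj : ∀ y ∈ L.head?, G.Adj a y) : IsPathList G (a :: L) :=
  ⟨List.isChain_cons.2 ⟨hadj, h.1⟩, List.nodup_cons.2 ⟨ha, h.2⟩⟩

theorem IsPathList.of_append_left {G : SimpleGraph V} {L L' : List V}
    (h : IsPathList G (L ++ L')) : IsPathList G L :=
  ⟨(List.isChain_append.1 h.1).1, (List.nodup_append.1 h.2).1⟩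

theorem IsPathList.of_append_right {G : SimpleGraph V} {L L' : List V}
    (h : IsPathList G (L ++ L')) : IsPathList G L' :=
  ⟨(List.isChain_append.1 h.1).2.1, (List.nodup_append.1 h.2).2.1⟩

theorem containsLinearForest_of_lists {G : SimpleGraph V} {ℓ : ℕ} {k : Fin ℓ → ℕ}
    (L : Fin ℓ → List V) (hL : ∀ i, IsPathList G (L i)) (hlen : ∀ i, (L i).length = k i)
    (hdisj : ∀ i j, i ≠ j → ∀ v ∈ L i, v ∉ L j) : ContainsLinearForest G k := by
  refine ⟨fun i a => (L i)[a.val]'(by rw [hlen]; exact a.2), ?_, ?_⟩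
  · rintro ⟨i, a⟩ ⟨j, b⟩ hab
    simp only at hab
    by_cases hij : i = j
    · subst hij
      have := (hL i).2.getElem_inj_iff.1 hab
      rw [Fin.ext this]
    · refine absurd ?_ (hdisj i j hij _ (List.getElem_mem (by rw [hlen]; exact a.2)))
      rw [hab]
      exact List.getElem_mem _
  · intro i a b hab
    have hc := List.isChain_iff_getElem.1 (hL i).1
    rw [SimpleGraph.pathGraph_adj] at hab
    rcases hab with hab | hab
    · have := hc a.val (by rw [hlen, hab]; exact b.2)
      simpa only [hab] using this
    · have := hc b.val (by rw [hlen, hab]; exact a.2)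
      simpa only [hab] using this.symm

theorem containsLinearForest_of_long_path {G : SimpleGraph V} {ℓ : ℕ} {k : Fin ℓ → ℕ}
    {L : List V} (hL : IsPathList G L) (hlen : ∑ i, k i ≤ L.length) :
    ContainsLinearForest G k := by
  have hc := List.isChain_iff_getElem.1 hL.1
  refine ⟨fun i a => L[(finSigmaFinEquiv (⟨i, a⟩ : (i : Fin ℓ) × Fin (k i))).val]'
    (lt_of_lt_of_le (Fin.is_lt _) hlen), ?_, ?_⟩
  · rintro q q' hq
    simp only at hq
    exact finSigmaFinEquiv.injective (Fin.ext (hL.2.getElem_inj_iff.1 hq))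
  · intro i a b hab
    rw [SimpleGraph.pathGraph_adj] at hab
    have hsucc : ∀ a b : Fin (k i), a.val + 1 = b.val →
        (finSigmaFinEquiv (⟨i, a⟩ : (i : Fin ℓ) × Fin (k i))).val + 1 =
          (finSigmaFinEquiv (⟨i, b⟩ : (i : Fin ℓ) × Fin (k i))).val := by
      intro a b hab
      simp only [finSigmaFinEquiv_apply]
      omega
    rcases hab with hab | hab
    · have := hc (finSigmaFinEquiv (⟨i, a⟩ : (i : Fin ℓ) × Fin (k i))).val
        (by rw [hsucc a b hab]; exact lt_of_lt_of_le (Fin.is_lt _) hlen)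
      simpa only [hsucc a b hab] using this
    · have := hc (finSigmaFinEquiv (⟨i, b⟩ : (i : Fin ℓ) × Fin (k i))).val
        (by rw [hsucc b a hab]; exact lt_of_lt_of_le (Fin.is_lt _) hlen)
      simpa only [hsucc b a hab] using this.symm

/-! ### Degrees into a set and the excess of a set -/

/-- The number of neighbours of `v` in `S`. -/
noncomputable def degIn (G : SimpleGraph V) (S : Finset V) (v : V) : ℕ :=
  (S.filter (G.Adj v)).card

/-- Twice the number of edges that meet `Y` and lie in `X ∪ Y`, minus `2 p |Y|`
(for disjoint `X` and `Y`). -/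
noncomputable def excess (G : SimpleGraph V) (p : ℕ) (X Y : Finset V) : ℤ :=
  ∑ v ∈ Y, ((degIn G Y v : ℤ) + 2 * degIn G X v - 2 * p)

/-- Every proper nonempty part of `C` sends an edge to the rest of `C`. -/
def CutConnected (G : SimpleGraph V) (C : Finset V) : Prop :=
  ∀ A ⊆ C, A.Nonempty → A ≠ C → ∃ a ∈ A, ∃ b ∈ C, b ∉ A ∧ G.Adj a b

section Degrees

variable {G : SimpleGraph V} {p : ℕ}

theorem degIn_le_card (S : Finset V) (v : V) : degIn G S v ≤ S.card :=
  Finset.card_filter_le _ _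

theorem degIn_pos_iff {S : Finset V} {v : V} : 0 < degIn G S v ↔ ∃ w ∈ S, G.Adj v w := by
  simp [degIn, Finset.card_pos, Finset.Nonempty]

theorem degIn_eq_zero_iff {S : Finset V} {v : V} :
    degIn G S v = 0 ↔ ∀ w ∈ S, ¬ G.Adj v w := by
  simp [degIn, Finset.filter_eq_empty_iff]

theorem degIn_eq_card_iff {S : Finset V} {v : V} :
    degIn G S v = S.card ↔ ∀ w ∈ S, G.Adj v w := by
  simp [degIn, Finset.card_filter_eq_iff]

theorem one_lt_degIn_iff {S : Finset V} {v : V} :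
    1 < degIn G S v ↔ ∃ a ∈ S, ∃ b ∈ S, G.Adj v a ∧ G.Adj v b ∧ a ≠ b := by
  rw [degIn, Finset.one_lt_card]
  simp only [Finset.mem_filter]
  constructor
  · rintro ⟨a, ⟨ha, ha'⟩, b, ⟨hb, hb'⟩, hab⟩
    exact ⟨a, ha, b, hb, ha', hb', hab⟩
  · rintro ⟨a, ha, b, hb, ha', hb', hab⟩
    exact ⟨a, ⟨ha, ha'⟩, b, ⟨hb, hb'⟩, hab⟩

theorem sum_degIn_comm (S T : Finset V) :
    ∑ v ∈ S, degIn G T v = ∑ v ∈ T, degIn G S v := by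
  simp only [degIn, Finset.card_filter]
  rw [Finset.sum_comm]
  simp only [G.adj_comm]

theorem sum_adj_eq_degIn (C : Finset V) (s : V) :
    ∑ v ∈ C, (if G.Adj v s then 1 else 0 : ℤ) = degIn G C s := by
  simp only [degIn, Finset.card_filter, G.adj_comm]
  push_cast
  rfl

theorem excess_singleton (X : Finset V) (v : V) :
    excess G p X {v} = 2 * degIn G X v - 2 * p := by
  have h : degIn G {v} v = 0 := by simp [degIn_eq_zero_iff]
  simp [excess, h]

variable [DecidableEq V]

theorem degIn_union {S T : Finset V} (h : Disjoint S T) (v : V) :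
    degIn G (S ∪ T) v = degIn G S v + degIn G T v := by
  rw [degIn, Finset.filter_union, Finset.card_union_of_disjoint]
  · rfl
  · exact Finset.disjoint_filter_filter h

theorem degIn_insert {S : Finset V} {s : V} (h : s ∉ S) (v : V) :
    degIn G (insert s S) v = degIn G S v + if G.Adj v s then 1 else 0 := by
  unfold degIn
  rw [Finset.filter_insert]
  split_ifs with hs
  · rw [Finset.card_insert_of_notMem]
    simp [h]
  · rfl

theorem degIn_erase_self {S : Finset V} (v : V) : degIn G (S.erase v) v = degIn G S v := by
  unfold degIn
  congr 1
  ext w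
  simp only [Finset.mem_filter, Finset.mem_erase]
  exact ⟨fun h => ⟨h.1.2, h.2⟩, fun h => ⟨⟨h.2.ne', h.1⟩, h.2⟩⟩

theorem degIn_lt_card {S : Finset V} {v : V} (hv : v ∈ S) : degIn G S v < S.card := by
  rw [← degIn_erase_self]
  exact (degIn_le_card _ _).trans_lt (Finset.card_erase_lt_of_mem hv)

theorem excess_union {X A B : Finset V} (hAB : Disjoint A B)
    (hno : ∀ a ∈ A, ∀ b ∈ B, ¬ G.Adj a b) :
    excess G p X (A ∪ B) = excess G p X A + excess G p X B := by
  unfold excess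
  rw [Finset.sum_union hAB]
  congr 1
  · refine Finset.sum_congr rfl fun v hv => ?_
    rw [degIn_union hAB, degIn_eq_zero_iff.2 (hno v hv)]
    simp
  · refine Finset.sum_congr rfl fun v hv => ?_
    rw [degIn_union hAB,
      (degIn_eq_zero_iff (S := A) (v := v)).2 fun a ha h => hno a ha v hv h.symm]
    simp

theorem excess_insert_left {X C : Finset V} {s : V} (hs : s ∉ C) (hX : s ∉ X) :
    excess G p X (insert s C) =
      excess G p (insert s X) C + 2 * degIn G X s - 2 * p := by
  unfold excess
  rw [Finset.sum_insert hs]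
  simp only [degIn_insert hs, degIn_insert hX, SimpleGraph.irrefl, if_false]
  have := sum_adj_eq_degIn (G := G) C s
  push_cast
  simp only [mul_add, Finset.sum_add_distrib, Finset.sum_sub_distrib, ← Finset.mul_sum]
  rw [this]
  ring

theorem excess_insert {X C : Finset V} {s : V} (hs : s ∉ C) :
    excess G p X (insert s C) =
      excess G p X C + 2 * degIn G C s + 2 * degIn G X s - 2 * p := by
  unfold excess
  rw [Finset.sum_insert hs]
  simp only [degIn_insert hs, SimpleGraph.irrefl, if_false]
  have := sum_adj_eq_degIn (G := G) C s
  push_cast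
  simp only [Finset.sum_add_distrib, Finset.sum_sub_distrib, ← Finset.mul_sum]
  rw [this]
  ring

/-- A minimal nonempty set of nonnegative excess is connected and has large degrees. -/
theorem exists_minimal_excess_nonneg {X Y : Finset V} (hY : Y.Nonempty)
    (hex : 0 ≤ excess G p X Y) :
    ∃ D ⊆ Y, D.Nonempty ∧ 0 ≤ excess G p X D ∧ CutConnected G D ∧
      (2 ≤ D.card → ∀ v ∈ D, p + 1 ≤ degIn G D v + degIn G X v) := by
  obtain ⟨D, hDY, hD⟩ := Finset.exists_le_minimal
    (Y.powerset.filter fun D => D.Nonempty ∧ 0 ≤ excess G p X D) (a := Y) (by simp [hY, hex])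
  have hmem := hD.1
  simp only [Finset.mem_filter, Finset.mem_powerset] at hmem
  obtain ⟨-, hne, hDex⟩ := hmem
  have hmin : ∀ A ⊆ D, A.Nonempty → A ≠ D → excess G p X A < 0 := by
    intro A hA hAne hAD
    by_contra! hcon
    refine hAD (hA.antisymm (hD.2 ?_ hA))
    simpa only [Finset.mem_filter, Finset.mem_powerset] using ⟨hA.trans hDY, hAne, hcon⟩
  refine ⟨D, hDY, hne, hDex, ?_, ?_⟩
  · intro A hA hAne hAD
    by_contra! hcon
    have hBne : (D \ A).Nonempty :=
      Finset.sdiff_nonempty.2 fun h => hAD (hA.antisymm h)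
    have hsum := excess_union (G := G) (p := p) (X := X) (A := A) (B := D \ A)
      Finset.disjoint_sdiff
      (fun a ha b hb => hcon a ha b (Finset.mem_sdiff.1 hb).1 (Finset.mem_sdiff.1 hb).2)
    rw [Finset.union_sdiff_of_subset hA] at hsum
    have h1 := hmin A hA hAne hAD
    have h2 := hmin (D \ A) Finset.sdiff_subset hBne (by
      intro h
      obtain ⟨a, ha⟩ := hAne
      have := hA ha
      rw [← h] at this
      exact (Finset.mem_sdiff.1 this).2 ha)
    omega
  · intro hcard v hv
    have h1 := hmin (D.erase v) (Finset.erase_subset _ _)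
      (by rw [← Finset.card_pos, Finset.card_erase_of_mem hv]; omega)
      (Finset.erase_ne_self.2 hv)
    have h2 := excess_insert (G := G) (p := p) (X := X) (Finset.notMem_erase v D)
    rw [Finset.insert_erase hv, degIn_erase_self] at h2
    omega

end Degrees

/-! ### Long paths in sets of large minimum degree -/

section LongPaths

variable {G : SimpleGraph V}

/-- The rotation step: a path whose end vertices have all their neighbours on it, and of total
degree at least its length, closes up. -/
theorem exists_closed_rearrangement {C : Finset V} {r : ℕ} {L : List V} (hL : IsPathList G L)
    (hne : L ≠ []) (hlen : L.length ≤ 2 * r)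
    (hhead : ∀ x ∈ L.head?, r ≤ degIn G C x ∧ ∀ w ∈ C, G.Adj x w → w ∈ L)
    (hlast : ∀ x ∈ L.getLast?, r ≤ degIn G C x ∧ ∀ w ∈ C, G.Adj x w → w ∈ L) :
    ∃ Z : List V, IsPathList G Z ∧ Z.length = L.length ∧ (∀ v, v ∈ Z ↔ v ∈ L) ∧
      ∀ x ∈ Z.getLast?, ∀ y ∈ Z.head?, G.Adj x y := by
  have hpos : 0 < L.length := List.length_pos_iff.2 hne
  obtain ⟨h0, h0'⟩ := hhead L[0] (by simp [List.head?_eq_getElem?])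
  obtain ⟨h1, h1'⟩ := hlast (L[L.length - 1]) (by simp [List.getLast?_eq_getElem?])
  set I := (Finset.range (L.length - 1)).filter fun i =>
    ∃ h : i + 1 < L.length, G.Adj L[0] L[i + 1] with hI
  set J := (Finset.range (L.length - 1)).filter fun i =>
    ∃ h : i < L.length, G.Adj L[i] (L[L.length - 1]) with hJ
  have hIcard : r ≤ I.card := by
    refine h0.trans ?_
    refine Finset.card_le_card_of_surjOn (fun i => L.getD (i + 1) L[0]) ?_
    intro w hw
    simp only [Finset.coe_filter, Set.mem_ofPred_eq] at hw
    obtain ⟨j, hj, rfl⟩ := List.getElem_of_mem (h0' w hw.1 hw.2)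
    have hj0 : j ≠ 0 := by
      rintro rfl
      exact G.irrefl hw.2
    refine ⟨j - 1, ?_, ?_⟩
    · rw [hI]
      simp only [Finset.coe_filter, Finset.mem_range, Set.mem_ofPred_eq]
      have : j - 1 + 1 = j := by omega
      refine ⟨by omega, by omega, ?_⟩
      simpa only [this] using hw.2
    · have : j - 1 + 1 = j := by omega
      simp [this, hj]
  have hJcard : r ≤ J.card := by
    refine h1.trans ?_
    refine Finset.card_le_card_of_surjOn (fun i => L.getD i L[0]) ?_
    intro w hw
    simp only [Finset.coe_filter, Set.mem_ofPred_eq] at hw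
    obtain ⟨j, hj, rfl⟩ := List.getElem_of_mem (h1' w hw.1 hw.2)
    have hj0 : j ≠ L.length - 1 := by
      rintro rfl
      exact G.irrefl hw.2
    refine ⟨j, ?_, ?_⟩
    · rw [hJ]
      simp only [Finset.coe_filter, Finset.mem_range, Set.mem_ofPred_eq]
      exact ⟨by omega, hj, hw.2.symm⟩
    · simp [hj]
  obtain ⟨i, hi⟩ : (I ∩ J).Nonempty := by
    rw [← Finset.card_pos]
    have hu : (I ∪ J).card ≤ L.length - 1 := by
      refine (Finset.card_le_card (t := Finset.range (L.length - 1)) ?_).trans (by simp)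
      exact Finset.union_subset (Finset.filter_subset _ _) (Finset.filter_subset _ _)
    have := Finset.card_union_add_card_inter I J
    omega
  obtain ⟨hiI, hiJ⟩ := Finset.mem_inter.1 hi
  obtain ⟨-, hi1, hadj0⟩ := Finset.mem_filter.1 hiI
  obtain ⟨-, hi2, hadj1⟩ := Finset.mem_filter.1 hiJ
  have hsplit : L.take (i + 1) ++ L.drop (i + 1) = L := List.take_append_drop _ _
  have hL' : IsPathList G (L.take (i + 1) ++ L.drop (i + 1)) := by rwa [hsplit]
  refine ⟨L.take (i + 1) ++ (L.drop (i + 1)).reverse, ?_, ?_, ?_, ?_⟩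
  · refine hL'.of_append_left.append hL'.of_append_right.reverse ?_ ?_
    · intro v hv hv'
      rw [List.mem_reverse] at hv'
      exact (List.nodup_append.1 hL'.2).2.2 v hv v hv' rfl
    · intro x hx y hy
      rw [List.head?_reverse] at hy
      have hx' : x = L[i] := by
        have h2 : (L.take (i + 1)).getLast? = some L[i] := by
          rw [List.getLast?_eq_getElem?, List.length_take, Nat.min_eq_left (by omega)]
          simp [hi2]
        rw [h2] at hx
        simpa using hx.symm
      have hy' : y = L[L.length - 1] := by
        have h2 : (L.drop (i + 1)).getLast? = some L[L.length - 1] := by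
          rw [List.getLast?_drop, if_neg (by omega), List.getLast?_eq_getElem?]
          simp [hpos]
        rw [h2] at hy
        simpa using hy.symm
      rw [hx', hy']
      exact hadj1
  · simp
    omega
  · intro v
    conv_rhs => rw [← hsplit]
    simp only [List.mem_append, List.mem_reverse]
  · intro x hx y hy
    have hy' : y = L[0] := by
      have h2 : (L.take (i + 1) ++ (L.drop (i + 1)).reverse).head? = some L[0] := by
        rw [List.head?_append, List.head?_take, if_neg (by omega), List.head?_eq_getElem?]
        simp [hpos]
      rw [h2] at hy
      simpa using hy.symm
    have hx' : x = L[i + 1] := by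
      have h2 : (L.take (i + 1) ++ (L.drop (i + 1)).reverse).getLast? = some L[i + 1] := by
        rw [List.getLast?_append, List.getLast?_reverse, List.head?_drop]
        simp [hi1]
      rw [h2] at hx
      simpa using hx.symm
    rw [hx', hy']
    exact hadj0.symm

variable [DecidableEq V]

theorem exists_path_avoiding {S : Finset V} {q : ℕ} (hS : ∀ v ∈ S, q ≤ degIn G S v) :
    ∀ (j : ℕ) (T : Finset V) (a : V), T.card + j ≤ q → a ∈ S → a ∉ T →
      ∃ L : List V, IsPathList G (a :: L) ∧ L.length = j ∧ ∀ v ∈ a :: L, v ∈ S ∧ v ∉ T := by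
  intro j
  induction j with
  | zero =>
    intro T a _ ha haT
    exact ⟨[], IsPathList.singleton G a, rfl, by simp [ha, haT]⟩
  | succ j ih =>
    intro T a hT ha haT
    have hlt : T.card < (S.filter (G.Adj a)).card := by
      have := hS a ha
      unfold degIn at this
      omega
    obtain ⟨b, hb, hbT⟩ := Finset.exists_mem_notMem_of_card_lt_card hlt
    rw [Finset.mem_filter] at hb
    obtain ⟨L, hL, hlen, hmem⟩ := ih (insert a T) b
      (by rw [Finset.card_insert_of_notMem haT]; omega) hb.1
      (by rw [Finset.mem_insert]; rintro (h | h); exacts [hb.2.ne' h, hbT h])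
    refine ⟨b :: L, hL.cons (fun h => (hmem a h).2 (Finset.mem_insert_self _ _)) ?_,
      by simp [hlen], ?_⟩
    · intro y hy
      simp only [List.head?_cons, Option.mem_def, Option.some.injEq] at hy
      exact hy ▸ hb.2
    · intro v hv
      rcases List.mem_cons.1 hv with rfl | hv
      · exact ⟨ha, haT⟩
      · exact ⟨(hmem v hv).1, fun h => (hmem v hv).2 (Finset.mem_insert_of_mem h)⟩

theorem exists_path_of_degIn {S : Finset V} {q : ℕ} (hS : ∀ v ∈ S, q ≤ degIn G S v)
    {a : V} (ha : a ∈ S) :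
    ∃ L : List V, IsPathList G (a :: L) ∧ L.length = q ∧ ∀ v ∈ a :: L, v ∈ S := by
  obtain ⟨L, hL, hlen, hmem⟩ := exists_path_avoiding hS q ∅ a (by simp) ha (by simp)
  exact ⟨L, hL, hlen, fun v hv => (hmem v hv).1⟩

theorem CutConnected.exists_path {C : Finset V} (hC : CutConnected G C) {a b : V}
    (ha : a ∈ C) (hb : b ∈ C) :
    ∃ L : List V, IsPathList G L ∧ L.head? = some a ∧ L.getLast? = some b ∧ ∀ v ∈ L, v ∈ C := by
  set R := C.filter fun b => ∃ L : List V, IsPathList G L ∧ L.head? = some a ∧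
    L.getLast? = some b ∧ ∀ v ∈ L, v ∈ C with hR
  by_cases hRC : R = C
  · rw [← hRC, hR, Finset.mem_filter] at hb
    exact hb.2
  exfalso
  obtain ⟨v, hv, w, hw, hwR, hvw⟩ := hC R (Finset.filter_subset _ _)
    ⟨a, Finset.mem_filter.2 ⟨ha, [a], IsPathList.singleton G a, rfl, rfl, by simp [ha]⟩⟩ hRC
  obtain ⟨-, L, hL, hLa, hLv, hLC⟩ := Finset.mem_filter.1 hv
  refine hwR (Finset.mem_filter.2 ⟨hw, ?_⟩)
  by_cases hwL : w ∈ L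
  · obtain ⟨s, t, rfl⟩ := List.append_of_mem hwL
    have hst : s ++ w :: t = (s ++ [w]) ++ t := by simp
    refine ⟨s ++ [w], ?_, ?_, by simp, ?_⟩
    · rw [hst] at hL
      exact hL.of_append_left
    · rw [← hLa]
      cases s <;> simp
    · intro x hx
      apply hLC
      rw [hst]
      exact List.mem_append_left _ hx
  · refine ⟨L ++ [w], hL.append (IsPathList.singleton G w) ?_ ?_, ?_, by simp, ?_⟩
    · intro x hx hxw
      rw [List.mem_singleton] at hxw
      exact hwL (hxw ▸ hx)
    · intro x hx y hy
      rw [hLv, Option.mem_def, Option.some.injEq] at hx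
      simp only [List.head?_cons, Option.mem_def, Option.some.injEq] at hy
      exact hx ▸ hy ▸ hvw
    · rw [List.head?_append, hLa]
      rfl
    · intro x hx
      rcases List.mem_append.1 hx with hx | hx
      · exact hLC x hx
      · rw [List.mem_singleton] at hx
        exact hx ▸ hw

/-- A closed path that misses a vertex of a connected set can be opened and extended. -/
theorem CutConnected.extend_closed {C : Finset V} (hC : CutConnected G C) {Z : List V}
    (hZ : IsPathList G Z) (hclosed : ∀ x ∈ Z.getLast?, ∀ y ∈ Z.head?, G.Adj x y)
    (hne : Z ≠ []) (hZC : ∀ v ∈ Z, v ∈ C) (hlt : Z.length < C.card) :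
    ∃ L : List V, IsPathList G L ∧ L.length = Z.length + 1 ∧ ∀ v ∈ L, v ∈ C := by
  obtain ⟨a, ha, b, hb, hbZ, hab⟩ := hC Z.toFinset
    (fun v hv => hZC v (List.mem_toFinset.1 hv)) (List.toFinset_nonempty_iff Z |>.2 hne)
    (fun h => by rw [← h, List.toFinset_card_of_nodup hZ.2] at hlt; exact lt_irrefl _ hlt)
  rw [List.mem_toFinset] at ha hbZ
  obtain ⟨s, t, rfl⟩ := List.append_of_mem ha
  refine ⟨b :: ((a :: t) ++ s), ?_, by simp; omega, ?_⟩
  · refine (hZ.of_append_right.append hZ.of_append_left ?_ ?_).cons ?_ ?_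
    · intro v hv hvs
      exact (List.nodup_append.1 hZ.2).2.2 v hvs v hv rfl
    · intro x hx y hy
      refine hclosed x ?_ y ?_
      · rw [List.getLast?_append, Option.mem_def.1 hx]
        rfl
      · rw [List.head?_append, Option.mem_def.1 hy]
        rfl
    · intro h
      apply hbZ
      rw [List.mem_append] at h ⊢
      exact h.symm
    · intro y hy
      simp only [List.cons_append, List.head?_cons, Option.mem_def, Option.some.injEq] at hy
      exact hy ▸ hab.symm
  · intro v hv
    rcases List.mem_cons.1 hv with rfl | hv
    · exact hb
    · apply hZC
      rw [List.mem_append] at hv ⊢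
      exact hv.symm

theorem CutConnected.extend_path {C : Finset V} (hC : CutConnected G C) {r : ℕ}
    (hdeg : ∀ v ∈ C, r ≤ degIn G C v) (hcard : 2 * r + 1 ≤ C.card) {L : List V}
    (hL : IsPathList G L) (hne : L ≠ []) (hLC : ∀ v ∈ L, v ∈ C) (hlen : L.length ≤ 2 * r) :
    ∃ L' : List V, IsPathList G L' ∧ L'.length = L.length + 1 ∧ ∀ v ∈ L', v ∈ C := by
  have hcons : ∀ L : List V, IsPathList G L → (∀ v ∈ L, v ∈ C) →
      ∀ x ∈ L.head?, ∀ w ∈ C, G.Adj x w → w ∉ L →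
      ∃ L' : List V, IsPathList G L' ∧ L'.length = L.length + 1 ∧ ∀ v ∈ L', v ∈ C := by
    intro L hL hLC x hx w hw hxw hwL
    refine ⟨w :: L, hL.cons hwL ?_, rfl, ?_⟩
    · intro y hy
      rw [Option.mem_def] at hx hy
      rw [hx, Option.some.injEq] at hy
      exact hy ▸ hxw.symm
    · intro v hv
      rcases List.mem_cons.1 hv with rfl | hv
      exacts [hw, hLC v hv]
  by_cases hhead : ∀ x ∈ L.head?, ∀ w ∈ C, G.Adj x w → w ∈ L
  swap
  · push Not at hhead
    obtain ⟨x, hx, w, hw, hxw, hwL⟩ := hhead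
    exact hcons L hL hLC x hx w hw hxw hwL
  by_cases hlast : ∀ x ∈ L.getLast?, ∀ w ∈ C, G.Adj x w → w ∈ L
  swap
  · push Not at hlast
    obtain ⟨x, hx, w, hw, hxw, hwL⟩ := hlast
    obtain ⟨L', h1, h2, h3⟩ := hcons L.reverse hL.reverse
      (fun v hv => hLC v (List.mem_reverse.1 hv)) x (by rwa [List.head?_reverse]) w hw hxw
      (fun h => hwL (List.mem_reverse.1 h))
    exact ⟨L', h1, by rw [h2, List.length_reverse], h3⟩
  obtain ⟨Z, hZ, hZlen, hZmem, hclosed⟩ := exists_closed_rearrangement (C := C) hL hne hlen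
    (fun x hx => ⟨hdeg x (hLC x (List.mem_of_mem_head? hx)), hhead x hx⟩)
    (fun x hx => ⟨hdeg x (hLC x (List.mem_of_mem_getLast? hx)), hlast x hx⟩)
  rw [← hZlen]
  refine hC.extend_closed hZ hclosed ?_ (fun v hv => hLC v ((hZmem v).1 hv)) (by omega)
  rintro rfl
  exact hne (List.length_eq_zero_iff.1 hZlen.symm)

theorem CutConnected.exists_long_path {C : Finset V} (hC : CutConnected G C) {r : ℕ}
    (hdeg : ∀ v ∈ C, r ≤ degIn G C v) (hcard : 2 * r + 1 ≤ C.card) :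
    ∃ L : List V, IsPathList G L ∧ L.length = 2 * r + 1 ∧ ∀ v ∈ L, v ∈ C := by
  suffices h : ∀ m ≤ 2 * r, ∃ L : List V, IsPathList G L ∧ L.length = m + 1 ∧
      ∀ v ∈ L, v ∈ C from h (2 * r) le_rfl
  intro m
  induction m with
  | zero =>
    intro _
    obtain ⟨a, ha⟩ := Finset.card_pos.1 (by omega : 0 < C.card)
    exact ⟨[a], IsPathList.singleton G a, rfl, by simp [ha]⟩
  | succ m ih =>
    intro hm
    obtain ⟨L, hL, hlen, hLC⟩ := ih (by omega)
    obtain ⟨L', h1, h2, h3⟩ := hC.extend_path hdeg hcard hL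
      (by rintro rfl; simp at hlen) hLC (by omega)
    exact ⟨L', h1, by omega, h3⟩

end LongPaths

/-! ### Bounded tree-depth and many sets of nonnegative excess -/

section TreeDepth

variable [DecidableEq V]

/-- The subgraph of `G` induced on the set has tree-depth at most the given number. -/
inductive TreeDepthLE (G : SimpleGraph V) : ℕ → Finset V → Prop
  | empty (d : ℕ) : TreeDepthLE G d ∅
  | root {d : ℕ} {s : V} {C : Finset V} (hs : s ∉ C) (h : TreeDepthLE G d C) :
      TreeDepthLE G (d + 1) (insert s C)
  | union {d : ℕ} {A B : Finset V} (hA : TreeDepthLE G d A) (hB : TreeDepthLE G d B)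
      (hdisj : Disjoint A B) (hno : ∀ a ∈ A, ∀ b ∈ B, ¬ G.Adj a b) :
      TreeDepthLE G d (A ∪ B)

variable {G : SimpleGraph V}

theorem treeDepthLE_of_components {d : ℕ} {W : Finset V}
    (hW : ∀ C ⊆ W, C.Nonempty → CutConnected G C →
      (∀ a ∈ C, ∀ b ∈ W, b ∉ C → ¬ G.Adj a b) → TreeDepthLE G d C) :
    TreeDepthLE G d W := by
  suffices h : ∀ Z : Finset V, Z ⊆ W → (∀ a ∈ Z, ∀ b ∈ W, b ∉ Z → ¬ G.Adj a b) →
      TreeDepthLE G d Z from h W subset_rfl fun a _ b hb hb' => absurd hb hb'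
  intro Z
  induction Z using Finset.strongInduction with
  | H Z ih =>
    intro hZW hZ
    rcases Z.eq_empty_or_nonempty with rfl | hne
    · exact TreeDepthLE.empty d
    obtain ⟨C, hCZ, hC⟩ := Finset.exists_le_minimal
      (Z.powerset.filter fun C => C.Nonempty ∧ ∀ a ∈ C, ∀ b ∈ W, b ∉ C → ¬ G.Adj a b)
      (a := Z) (by simpa [hne] using hZ)
    have hmem := hC.1
    simp only [Finset.mem_filter, Finset.mem_powerset] at hmem
    obtain ⟨-, hCne, hCclosed⟩ := hmem
    have hCconn : CutConnected G C := by
      intro A hA hAne hAC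
      by_contra! hcon
      refine hAC (hA.antisymm (hC.2 ?_ hA))
      simp only [Finset.mem_filter, Finset.mem_powerset]
      refine ⟨hA.trans hCZ, hAne, fun a ha b hb hbA => ?_⟩
      by_cases hbC : b ∈ C
      · exact hcon a ha b hbC hbA
      · exact hCclosed a (hA ha) b hb hbC
    have hCW : C ⊆ W := Finset.Subset.trans hCZ hZW
    rw [← Finset.union_sdiff_of_subset hCZ]
    refine (hW C hCW hCne hCconn hCclosed).union (ih (Z \ C) ?_ ?_ ?_)
      Finset.disjoint_sdiff ?_
    · exact Finset.sdiff_ssubset hCZ hCne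
    · exact Finset.sdiff_subset.trans hZW
    · intro a ha b hb hbZ
      rw [Finset.mem_sdiff] at ha hbZ
      by_cases hbC : b ∈ C
      · exact fun h => hCclosed b hbC a (hZW ha.1) ha.2 h.symm
      · exact hZ a ha.1 b hb fun h => hbZ ⟨h, hbC⟩
    · intro a ha b hb
      rw [Finset.mem_sdiff] at hb
      exact hCclosed a ha b (hZW hb.1) hb.2

theorem treeDepthLE_of_rooted {d : ℕ} : ∀ {C : Finset V} {s : V}, CutConnected G C → s ∈ C →
    (∀ L : List V, IsPathList G (s :: L) → (∀ v ∈ s :: L, v ∈ C) → L.length + 1 ≤ d) →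
    TreeDepthLE G d C := by
  induction d with
  | zero =>
    intro C s _ hs hpath
    have := hpath [] (IsPathList.singleton G s) (by simp [hs])
    omega
  | succ d ih =>
    intro C s hC hs hpath
    rw [← Finset.insert_erase hs]
    refine TreeDepthLE.root (Finset.notMem_erase s C) (treeDepthLE_of_components ?_)
    intro C' hC' hne hconn hclosed
    have hC'C : C' ⊆ C := hC'.trans (Finset.erase_subset _ _)
    have hsC' : s ∉ C' := fun h => Finset.notMem_erase s C (hC' h)
    obtain ⟨a, ha, b, hb, hbC', hab⟩ := hC C' hC'C hne (fun h => hsC' (h ▸ hs))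
    have hbs : b = s := by
      by_contra hbs
      exact hclosed a ha b (Finset.mem_erase.2 ⟨hbs, hb⟩) hbC' hab
    subst hbs
    refine ih hconn ha fun L hL hLC' => ?_
    have := hpath (a :: L) (hL.cons (fun h => hsC' (hLC' _ h)) (by simpa using hab.symm)) (by
      intro v hv
      rcases List.mem_cons.1 hv with rfl | hv
      exacts [hs, hC'C (hLC' v hv)])
    simpa using this

theorem treeDepthLE_of_no_path {d : ℕ} (W : Finset V)
    (hpath : ∀ L : List V, IsPathList G L → L.length ≤ d) : TreeDepthLE G d W := by
  refine treeDepthLE_of_components fun C _ hne hC _ => ?_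
  obtain ⟨s, hs⟩ := hne
  exact treeDepthLE_of_rooted hC hs fun L hL _ => hpath _ hL

/-- A family of pairwise disjoint nonempty subsets of `Y` of nonnegative excess over `X`. -/
structure IsDenseFamily (G : SimpleGraph V) (p : ℕ) (X Y : Finset V)
    (F : Finset (Finset V)) : Prop where
  subset : ∀ S ∈ F, S ⊆ Y
  nonempty : ∀ S ∈ F, S.Nonempty
  excess_nonneg : ∀ S ∈ F, 0 ≤ excess G p X S
  disjoint : ∀ S ∈ F, ∀ T ∈ F, S ≠ T → Disjoint S T

/-- The coefficients `(B, K)` in the bound `B * excess + |Y| ≤ K * |F|` at tree-depth `d`,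
when dense families over at most `D` vertices have at most `M` members. -/
def depthCoeff (M D : ℕ) : ℕ → ℕ × ℕ
  | 0 => (1, 0)
  | d + 1 =>
    let B := (depthCoeff M D d).1
    let A := M * (depthCoeff M D d).2 + 1 + 2 * B * D
    (A + B, A * A + A)

theorem one_le_depthCoeff (M D d : ℕ) : 1 ≤ (depthCoeff M D d).1 := by
  induction d with
  | zero => exact le_rfl
  | succ d ih =>
    simp only [depthCoeff]
    omega

theorem exists_denseFamily_of_treeDepthLE {p M D : ℕ}
    (hM : ∀ X Y : Finset V, X.card ≤ D → Disjoint X Y → ∀ F, IsDenseFamily G p X Y F →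
      F.card ≤ M)
    {d : ℕ} {Y : Finset V} (h : TreeDepthLE G d Y) :
    ∀ X : Finset V, X.card + d ≤ D → Disjoint X Y → ∃ F, IsDenseFamily G p X Y F ∧
      ((depthCoeff M D d).1 : ℤ) * excess G p X Y + Y.card ≤ (depthCoeff M D d).2 * F.card := by
  induction h with
  | empty d =>
    intro X _ _
    exact ⟨∅, ⟨by simp, by simp, by simp, by simp⟩, by simp [excess]⟩
  | @root d s C hs h ih =>
    intro X hX hdisj
    have hsX : s ∉ X := fun h => Finset.disjoint_left.1 hdisj h (Finset.mem_insert_self _ _)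
    have hdisj' : Disjoint (insert s X) C := by
      rw [Finset.disjoint_insert_left]
      exact ⟨hs, hdisj.mono_right (Finset.subset_insert _ _)⟩
    have hXs : (insert s X).card = X.card + 1 := Finset.card_insert_of_notMem hsX
    obtain ⟨F, hF, hbound⟩ := ih (insert s X) (by omega) hdisj'
    have hFM := hM _ _ (by omega) hdisj' F hF
    have hmove := excess_insert_left (G := G) (p := p) hs hsX
    have hdeg := degIn_le_card (G := G) X s
    have hB := one_le_depthCoeff M D d
    simp only [depthCoeff]
    set B := (depthCoeff M D d).1
    set K := (depthCoeff M D d).2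
    set w := excess G p X (insert s C)
    set A := M * K + 1 + 2 * B * D with hA
    have hcard : (insert s C).card = C.card + 1 := Finset.card_insert_of_notMem hs
    have hKM : (K : ℤ) * F.card ≤ M * K := by
      rw [mul_comm]
      exact_mod_cast Nat.mul_le_mul_right K hFM
    have hdegD : (degIn G X s : ℤ) ≤ D := by exact_mod_cast hdeg.trans (by omega)
    have hroot : (B : ℤ) * w + (insert s C).card ≤ A := by
      rw [hmove, hcard, hA]
      push_cast
      have h1 : (B : ℤ) * degIn G X s ≤ B * D := mul_le_mul_of_nonneg_left hdegD (by positivity)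
      have h2 : (0 : ℤ) ≤ B * p := by positivity
      nlinarith
    have hcard0 : (0 : ℤ) ≤ (insert s C).card := by positivity
    have hB' : (1 : ℤ) ≤ B := by exact_mod_cast hB
    have hA0 : (0 : ℤ) ≤ A := by positivity
    by_cases hw : 0 ≤ w
    · refine ⟨{insert s C}, ⟨by simp, by simp, by simpa using hw, ?_⟩, ?_⟩
      · intro S hS T hT hST
        rw [Finset.mem_singleton] at hS hT
        exact absurd (hS.trans hT.symm) hST
      · have hwA : w ≤ A := by nlinarith
        rw [Finset.card_singleton]
        push_cast
        nlinarith [mul_le_mul_of_nonneg_left hwA hA0]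
    · refine ⟨∅, ⟨by simp, by simp, by simp, by simp⟩, ?_⟩
      have hw' : w ≤ -1 := by omega
      rw [Finset.card_empty]
      push_cast
      nlinarith [mul_le_mul_of_nonneg_left hw' hA0]
  | @union d A B hA hB hdisj hno ihA ihB =>
    intro X hX hXAB
    rw [Finset.disjoint_union_right] at hXAB
    obtain ⟨F, hF, hFb⟩ := ihA X hX hXAB.1
    obtain ⟨F', hF', hFb'⟩ := ihB X hX hXAB.2
    have hcross : ∀ S ∈ F, ∀ T ∈ F', Disjoint S T := fun S hS T hT =>
      hdisj.mono (hF.subset S hS) (hF'.subset T hT)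
    have hFF' : Disjoint F F' := by
      rw [Finset.disjoint_left]
      intro S hS hS'
      have := hcross S hS S hS'
      rw [disjoint_self] at this
      exact (hF.nonempty S hS).ne_empty this
    refine ⟨F ∪ F', ⟨?_, ?_, ?_, ?_⟩, ?_⟩
    · intro S hS
      rcases Finset.mem_union.1 hS with hS | hS
      · exact (hF.subset S hS).trans Finset.subset_union_left
      · exact (hF'.subset S hS).trans Finset.subset_union_right
    · intro S hS
      rcases Finset.mem_union.1 hS with hS | hS
      exacts [hF.nonempty S hS, hF'.nonempty S hS]
    · intro S hS
      rcases Finset.mem_union.1 hS with hS | hS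
      exacts [hF.excess_nonneg S hS, hF'.excess_nonneg S hS]
    · intro S hS T hT hST
      rcases Finset.mem_union.1 hS with hS | hS <;> rcases Finset.mem_union.1 hT with hT | hT
      exacts [hF.disjoint S hS T hT hST, hcross S hS T hT, (hcross T hT S hS).symm,
        hF'.disjoint S hS T hT hST]
    · rw [excess_union hdisj hno, Finset.card_union_of_disjoint hdisj,
        Finset.card_union_of_disjoint hFF']
      push_cast
      linarith

/-- A large graph without long paths and with about `p` edges per vertex has many disjoint
sets of nonnegative excess over a bounded set. -/
theorem exists_denseFamily [Fintype V] {p M d c : ℕ}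
    (hpath : ∀ L : List V, IsPathList G L → L.length ≤ d)
    (hex : -(c : ℤ) ≤ excess G p ∅ Finset.univ)
    (hcard : (depthCoeff M d d).1 * c + (depthCoeff M d d).2 * M < Fintype.card V) :
    ∃ X Y : Finset V, X.card ≤ d ∧ Disjoint X Y ∧ ∃ F, IsDenseFamily G p X Y F ∧ M < F.card := by
  by_contra! hcon
  obtain ⟨F, hF, hbound⟩ := exists_denseFamily_of_treeDepthLE (M := M) (D := d) (p := p)
    (fun X Y hX hXY F hF => hcon X Y hX hXY F hF)
    (treeDepthLE_of_no_path Finset.univ hpath) ∅ (by simp) (by simp)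
  have hFM := hcon ∅ Finset.univ (by simp) (by simp) F hF
  rw [Finset.card_univ] at hbound
  set B := (depthCoeff M d d).1
  set K := (depthCoeff M d d).2
  have h1 : (B : ℤ) * -(c : ℤ) ≤ B * excess G p ∅ Finset.univ :=
    mul_le_mul_of_nonneg_left hex (by positivity)
  have h2 : (K : ℤ) * F.card ≤ K * M := by exact_mod_cast Nat.mul_le_mul_left K hFM
  have h3 : (B : ℤ) * c + K * M < Fintype.card V := by exact_mod_cast hcard
  linarith

end TreeDepth

/-! ### Hub systems -/

section HubSystems

variable {G : SimpleGraph V} {ι : Type*}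

/-- The disjoint branches `D i`, `i ∈ I`, each of which links any two hubs in `X`, contains
a path on `e` vertices starting next to any given hub, and contains a path on `f` vertices. -/
structure IsHubSystem (G : SimpleGraph V) (X : Finset V) (I : Finset ι) (D : ι → Finset V)
    (e f : ℕ) : Prop where
  disjoint : ∀ i ∈ I, ∀ j ∈ I, i ≠ j → Disjoint (D i) (D j)
  notMem : ∀ i ∈ I, ∀ v ∈ D i, v ∉ X
  link : ∀ i ∈ I, ∀ x ∈ X, ∀ y ∈ X, ∃ Q, IsPathList G Q ∧ (∀ v ∈ Q, v ∈ D i) ∧ Q ≠ [] ∧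
    (∀ a ∈ Q.head?, G.Adj x a) ∧ ∀ b ∈ Q.getLast?, G.Adj b y
  tail : ∀ i ∈ I, ∀ x ∈ X, ∃ Q, IsPathList G Q ∧ (∀ v ∈ Q, v ∈ D i) ∧ Q.length = e ∧
    ∀ a ∈ Q.head?, G.Adj x a
  free : ∀ i ∈ I, ∃ Q, IsPathList G Q ∧ (∀ v ∈ Q, v ∈ D i) ∧ Q.length = f

/-- The vertex `v` lies in `A` or in one of the branches indexed by `J`. -/
def InRegion (D : ι → Finset V) (A : Finset V) (J : Finset ι) (v : V) : Prop :=
  v ∈ A ∨ ∃ j ∈ J, v ∈ D j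

theorem InRegion.mono {D : ι → Finset V} {A B : Finset V} {J K : Finset ι} {v : V}
    (h : InRegion D A J v) (hA : A ⊆ B) (hJ : J ⊆ K) : InRegion D B K v :=
  h.imp (fun h => hA h) fun ⟨j, hj, hv⟩ => ⟨j, hJ hj, hv⟩

variable {X : Finset V} {I : Finset ι} {D : ι → Finset V} {e f : ℕ}

theorem IsHubSystem.notMem_of_inRegion (hS : IsHubSystem G X I D e f) {A B : Finset V}
    {J K : Finset ι} (hA : A ⊆ X) (hB : B ⊆ X) (hJ : J ⊆ I) (hK : K ⊆ I)
    (hAB : Disjoint A B) (hJK : Disjoint J K) {v : V} (h : InRegion D A J v) :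
    ¬ InRegion D B K v := by
  rintro (h' | ⟨k, hk, h'⟩) <;> rcases h with h | ⟨j, hj, h⟩
  · exact Finset.disjoint_left.1 hAB h h'
  · exact hS.notMem j (hJ hj) v h (hB h')
  · exact hS.notMem k (hK hk) v h' (hA h)
  · exact Finset.disjoint_left.1
      (hS.disjoint j (hJ hj) k (hK hk) (fun hjk => Finset.disjoint_left.1 hJK hj (hjk ▸ hk))) h h'

variable [DecidableEq V] [DecidableEq ι]

/-- The hubs `u :: us` lie, in this order, on a path that starts at `u`, ends at a hub, and
passes through a branch between any two consecutive hubs. -/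
theorem IsHubSystem.exists_chain (hS : IsHubSystem G X I D e f) (us : List V) :
    ∀ (u : V) (J : Finset ι), J ⊆ I → (u :: us).Nodup → (∀ v ∈ u :: us, v ∈ X) →
      us.length ≤ J.card →
      ∃ L, IsPathList G (u :: L) ∧ 2 * us.length ≤ L.length ∧
        (∃ x ∈ X, (u :: L).getLast? = some x) ∧
        ∀ v ∈ u :: L, InRegion D (u :: us).toFinset J v := by
  induction us with
  | nil =>
    intro u J _ _ hX _
    exact ⟨[], .singleton G u, by simp, ⟨u, hX u (by simp), rfl⟩, by simp [InRegion]⟩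
  | cons a us ih =>
    intro u J hJ hnd hX hlen
    obtain ⟨j, hj⟩ : J.Nonempty := by
      rw [← Finset.card_pos]
      simp only [List.length_cons] at hlen
      omega
    have haX : a ∈ X := hX a (by simp)
    have huX : u ∈ X := hX u (by simp)
    obtain ⟨L, hL, hLlen, ⟨x, hx, hlast⟩, hreg⟩ := ih a (J.erase j)
      ((Finset.erase_subset _ _).trans hJ) (List.nodup_cons.1 hnd).2
      (fun v hv => hX v (List.mem_cons_of_mem _ hv)) (by
        rw [Finset.card_erase_of_mem hj]
        simp only [List.length_cons] at hlen
        omega)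
    obtain ⟨Q, hQ, hQD, hQne, hQhead, hQlast⟩ := hS.link j (hJ hj) u huX a haX
    have htail : ∀ v ∈ a :: us, v ∈ X := fun v hv => hX v (List.mem_cons_of_mem _ hv)
    have hQreg : ∀ v ∈ Q, ¬ InRegion D (a :: us).toFinset (J.erase j) v := by
      intro v hv
      refine hS.notMem_of_inRegion (A := ∅) (J := {j}) (Finset.empty_subset _) (fun w hw => ?_)
        (Finset.singleton_subset_iff.2 (hJ hj)) ((Finset.erase_subset _ _).trans hJ)
        (Finset.disjoint_empty_left _) (by simp) (Or.inr ⟨j, by simp, hQD v hv⟩)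
      exact htail w (List.mem_toFinset.1 hw)
    have hureg : ¬ InRegion D (a :: us).toFinset (J.erase j) u := by
      rintro (h | ⟨i, hi, h⟩)
      · exact (List.nodup_cons.1 hnd).1 (List.mem_toFinset.1 h)
      · exact hS.notMem i (hJ (Finset.mem_of_mem_erase hi)) u h huX
    have hpath : IsPathList G (Q ++ a :: L) :=
      hQ.append hL (fun v hv hv' => hQreg v hv (hreg v hv')) (by
        intro b hb y hy
        simp only [List.head?_cons, Option.mem_def, Option.some.injEq] at hy
        exact hy ▸ hQlast b hb)
    refine ⟨Q ++ a :: L, hpath.cons ?_ ?_, ?_, ⟨x, hx, ?_⟩, ?_⟩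
    · intro hu
      rcases List.mem_append.1 hu with hu | hu
      · exact hS.notMem j (hJ hj) u (hQD u hu) huX
      · exact hureg (hreg u hu)
    · intro y hy
      refine hQhead y ?_
      rwa [List.head?_append_of_ne_nil _ hQne] at hy
    · have := List.length_pos_iff.2 hQne
      simp only [List.length_append, List.length_cons]
      omega
    · rw [← List.cons_append, List.getLast?_append, hlast]
      rfl
    · intro v hv
      rcases List.mem_cons.1 hv with rfl | hv
      · exact Or.inl (by simp)
      rcases List.mem_append.1 hv with hv | hv
      · exact Or.inr ⟨j, hj, hQD v hv⟩
      · refine (hreg v hv).mono ?_ (Finset.erase_subset _ _)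
        intro w hw
        exact List.mem_toFinset.2 (List.mem_cons_of_mem _ (List.mem_toFinset.1 hw))

/-- A path on `k` vertices through the hubs in `A` and the branches in `J`. -/
theorem IsHubSystem.exists_path (hS : IsHubSystem G X I D e f) {A : Finset V} (hA : A ⊆ X)
    {J : Finset ι} (hJ : J ⊆ I) (hcard : A.card + 1 ≤ J.card) {k : ℕ}
    (hk : A.card = 0 ∧ k ≤ f ∨ 1 ≤ A.card ∧ k + 1 ≤ 2 * A.card + 2 * e) :
    ∃ L, IsPathList G L ∧ L.length = k ∧ ∀ v ∈ L, InRegion D A J v := by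
  suffices h : ∃ L, IsPathList G L ∧ k ≤ L.length ∧ ∀ v ∈ L, InRegion D A J v by
    obtain ⟨L, hL, hlen, hreg⟩ := h
    exact ⟨L.take k, hL.take k, by simpa using hlen, fun v hv => hreg v (List.mem_of_mem_take hv)⟩
  rcases hk with ⟨-, hk⟩ | ⟨hpos, hk⟩
  · obtain ⟨j, hj⟩ : J.Nonempty := by
      rw [← Finset.card_pos]
      omega
    obtain ⟨Q, hQ, hQD, hlen⟩ := hS.free j (hJ hj)
    exact ⟨Q, hQ, hlen ▸ hk, fun v hv => Or.inr ⟨j, hj, hQD v hv⟩⟩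
  obtain ⟨i, hi, j, hj, hij⟩ := Finset.one_lt_card.1 (by omega : 1 < J.card)
  have hlist : A.toList.length = A.card := Finset.length_toList A
  obtain ⟨u, us, hus⟩ : ∃ u us, A.toList = u :: us := by
    cases h : A.toList with
    | nil => simp [h] at hlist; omega
    | cons u us => exact ⟨u, us, rfl⟩
  have hAus : (u :: us).toFinset = A := by rw [← hus, Finset.toList_toFinset]
  have husA : ∀ v ∈ u :: us, v ∈ A := fun v hv => by rwa [← hus, Finset.mem_toList] at hv
  set K := (J.erase i).erase j with hK
  have hKJ : K ⊆ J := (Finset.erase_subset _ _).trans (Finset.erase_subset _ _)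
  have hKcard : K.card = J.card - 2 := by
    rw [hK, Finset.card_erase_of_mem (Finset.mem_erase.2 ⟨hij.symm, hj⟩),
      Finset.card_erase_of_mem hi]
    omega
  rw [hus, List.length_cons] at hlist
  obtain ⟨L, hL, hLlen, ⟨x, hx, hlast⟩, hreg⟩ := hS.exists_chain us u K (hKJ.trans hJ)
    (hus ▸ Finset.nodup_toList A) (fun v hv => hA (husA v hv)) (by omega)
  rw [hAus] at hreg
  obtain ⟨Q, hQ, hQD, hQlen, hQhead⟩ := hS.tail i (hJ hi) u (hA (husA u (by simp)))
  obtain ⟨R, hR, hRD, hRlen, hRhead⟩ := hS.tail j (hJ hj) x hx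
  have hnotK : ∀ l ∈ J, l ∉ K → ∀ v ∈ D l, ¬ InRegion D A K v := fun l hl hlK v hv =>
    hS.notMem_of_inRegion (A := ∅) (J := {l}) (Finset.empty_subset _) hA
      (Finset.singleton_subset_iff.2 (hJ hl)) (hKJ.trans hJ) (Finset.disjoint_empty_left _)
      (by simpa using hlK) (Or.inr ⟨l, by simp, hv⟩)
  have hLR : IsPathList G ((u :: L) ++ R) := by
    refine hL.append hR (fun v hv hv' => hnotK j hj (by simp [hK]) v (hRD v hv') (hreg v hv)) ?_
    intro y hy z hz
    rw [hlast, Option.mem_some_iff] at hy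
    exact hy ▸ hRhead z hz
  refine ⟨Q.reverse ++ ((u :: L) ++ R), hQ.reverse.append hLR ?_ ?_, ?_, ?_⟩
  · intro v hv hv'
    have hvi := hQD v (List.mem_reverse.1 hv)
    rcases List.mem_append.1 hv' with hv' | hv'
    · exact hnotK i hi (by simp [hK]) v hvi (hreg v hv')
    · exact Finset.disjoint_left.1 (hS.disjoint i (hJ hi) j (hJ hj) hij) hvi (hRD v hv')
  · intro y hy z hz
    rw [List.getLast?_reverse] at hy
    simp only [List.cons_append, List.head?_cons, Option.mem_def, Option.some.injEq] at hz
    exact hz ▸ (hQhead y hy).symm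
  · simp only [List.length_append, List.length_cons, List.length_reverse]
    omega
  · intro v hv
    rcases List.mem_append.1 hv with hv | hv
    · exact Or.inr ⟨i, hi, hQD v (List.mem_reverse.1 hv)⟩
    rcases List.mem_append.1 hv with hv | hv
    · exact (hreg v hv).mono subset_rfl hKJ
    · exact Or.inr ⟨j, hj, hRD v hv⟩

/-- Disjoint paths on prescribed numbers `k s` of vertices, the `s`-th one using `h s` hubs. -/
theorem IsHubSystem.exists_disjoint_paths (hS : IsHubSystem G X I D e f) {σ : Type*}
    [DecidableEq σ] {k h : σ → ℕ} (S : Finset σ) :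
    ∀ (A : Finset V) (J : Finset ι), A ⊆ X → J ⊆ I → ∑ s ∈ S, h s ≤ A.card →
      ∑ s ∈ S, (h s + 1) ≤ J.card →
      (∀ s ∈ S, h s = 0 ∧ k s ≤ f ∨ 1 ≤ h s ∧ k s + 1 ≤ 2 * h s + 2 * e) →
      ∃ L : σ → List V, (∀ s ∈ S, IsPathList G (L s) ∧ (L s).length = k s ∧
        ∀ v ∈ L s, InRegion D A J v) ∧
        ∀ s ∈ S, ∀ t ∈ S, s ≠ t → ∀ v ∈ L s, v ∉ L t := by
  induction S using Finset.induction_on with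
  | empty => intro A J _ _ _ _ _; exact ⟨fun _ => [], by simp⟩
  | insert s S hs ih =>
    intro A J hA hJ hsA hsJ hk
    rw [Finset.sum_insert hs] at hsA hsJ
    obtain ⟨B, hBA, hB⟩ := Finset.exists_subset_card_eq (by omega : h s ≤ A.card)
    obtain ⟨K, hKJ, hK⟩ := Finset.exists_subset_card_eq (by omega : h s + 1 ≤ J.card)
    obtain ⟨P, hP, hPlen, hPreg⟩ := hS.exists_path (hBA.trans hA) (hKJ.trans hJ)
      (by omega) (k := k s) (by rw [hB]; exact hk s (Finset.mem_insert_self _ _))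
    obtain ⟨L, hL, hLdisj⟩ := ih (A \ B) (J \ K) (Finset.sdiff_subset.trans hA)
      (Finset.sdiff_subset.trans hJ) (by rw [Finset.card_sdiff_of_subset hBA]; omega)
      (by rw [Finset.card_sdiff_of_subset hKJ]; omega)
      (fun t ht => hk t (Finset.mem_insert_of_mem ht))
    have hPL : ∀ t ∈ S, ∀ v ∈ P, v ∉ L t := fun t ht v hv hv' =>
      hS.notMem_of_inRegion (hBA.trans hA) (Finset.sdiff_subset.trans hA) (hKJ.trans hJ)
        (Finset.sdiff_subset.trans hJ) Finset.disjoint_sdiff Finset.disjoint_sdiff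
        (hPreg v hv) ((hL t ht).2.2 v hv')
    have hne : ∀ t ∈ S, t ≠ s := fun t ht hts => hs (hts ▸ ht)
    refine ⟨Function.update L s P, ?_, ?_⟩
    · intro t ht
      rcases Finset.mem_insert.1 ht with rfl | ht
      · rw [Function.update_self]
        exact ⟨hP, hPlen, fun v hv => (hPreg v hv).mono hBA hKJ⟩
      · rw [Function.update_of_ne (hne t ht)]
        obtain ⟨h1, h2, h3⟩ := hL t ht
        exact ⟨h1, h2, fun v hv => (h3 v hv).mono Finset.sdiff_subset Finset.sdiff_subset⟩
    · intro t ht t' ht' htt' v hv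
      rcases Finset.mem_insert.1 ht with rfl | hm <;>
        rcases Finset.mem_insert.1 ht' with rfl | hm'
      · exact absurd rfl htt'
      · rw [Function.update_self] at hv
        rw [Function.update_of_ne (hne t' hm')]
        exact hPL t' hm' v hv
      · rw [Function.update_of_ne (hne t hm)] at hv
        rw [Function.update_self]
        exact fun hv' => hPL t hm v hv' hv
      · rw [Function.update_of_ne (hne t hm)] at hv
        rw [Function.update_of_ne (hne t' hm')]
        exact hLdisj t hm t' hm' htt' v hv

theorem IsHubSystem.containsLinearForest (hS : IsHubSystem G X I D e f) {ℓ : ℕ}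
    {k h : Fin ℓ → ℕ} (hX : ∑ i, h i ≤ X.card) (hI : ∑ i, (h i + 1) ≤ I.card)
    (hk : ∀ i, h i = 0 ∧ k i ≤ f ∨ 1 ≤ h i ∧ k i + 1 ≤ 2 * h i + 2 * e) :
    ContainsLinearForest G k := by
  obtain ⟨L, hL, hdisj⟩ := hS.exists_disjoint_paths Finset.univ X I subset_rfl subset_rfl hX hI
    fun i _ => hk i
  exact containsLinearForest_of_lists L (fun i => (hL i (Finset.mem_univ i)).1)
    (fun i => (hL i (Finset.mem_univ i)).2.1)
    fun i j hij => hdisj i (Finset.mem_univ i) j (Finset.mem_univ j) hij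

end HubSystems

/-! ### A large set of common neighbours -/

section CommonNeighbours

variable {G : SimpleGraph V} {ι : Type*} [DecidableEq V]

theorem isHubSystem_of_cutConnected {X : Finset V} {I : Finset ι} {D : ι → Finset V} {q f : ℕ}
    (hdisj : ∀ i ∈ I, ∀ j ∈ I, i ≠ j → Disjoint (D i) (D j))
    (hX : ∀ i ∈ I, ∀ v ∈ D i, v ∉ X) (hconn : ∀ i ∈ I, CutConnected G (D i))
    (hhub : ∀ i ∈ I, ∀ x ∈ X, ∃ a ∈ D i, G.Adj x a)
    (hdeg : ∀ i ∈ I, ∀ v ∈ D i, q ≤ degIn G (D i) v)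
    (hfree : ∀ i ∈ I, ∃ Q, IsPathList G Q ∧ (∀ v ∈ Q, v ∈ D i) ∧ Q.length = f) :
    IsHubSystem G X I D (q + 1) f where
  disjoint := hdisj
  notMem := hX
  link := by
    intro i hi x hx y hy
    obtain ⟨a, ha, hxa⟩ := hhub i hi x hx
    obtain ⟨b, hb, hyb⟩ := hhub i hi y hy
    obtain ⟨Q, hQ, hhead, hlast, hQD⟩ := (hconn i hi).exists_path ha hb
    refine ⟨Q, hQ, hQD, ?_, ?_, ?_⟩
    · rintro rfl
      simp at hhead
    · simpa [hhead] using hxa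
    · simpa [hlast] using hyb.symm
  tail := by
    intro i hi x hx
    obtain ⟨a, ha, hxa⟩ := hhub i hi x hx
    obtain ⟨L, hL, hlen, hLD⟩ := exists_path_of_degIn (hdeg i hi) ha
    exact ⟨a :: L, hL, hLD, by simp [hlen], by simpa using hxa⟩
  free := hfree

theorem sum_half_sub_le {σ : Type*} [Fintype σ] [Nontrivial σ] {m : σ → ℕ}
    (hm : ∀ i, 1 ≤ m i) {p r : ℕ} (hp : p + 1 = ∑ i, m i) (hr : 1 ≤ r) :
    ∑ i, (m i - r) ≤ p - r := by
  classical
  by_cases h : ∃ i, r < m i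
  · obtain ⟨i, hi⟩ := h
    obtain ⟨j, hj⟩ := exists_ne i
    have hlt : ∑ s ∈ Finset.univ.erase i, (m s - r) < ∑ s ∈ Finset.univ.erase i, m s :=
      Finset.sum_lt_sum_of_nonempty ⟨j, by simpa using hj⟩ fun s _ => by
        have := hm s
        omega
    rw [← Finset.add_sum_erase _ _ (Finset.mem_univ i)] at hp ⊢
    omega
  · push Not at h
    rw [Finset.sum_eq_zero fun i _ => Nat.sub_eq_zero_of_le (h i)]
    exact Nat.zero_le _

theorem sum_sub_single_add_one {σ : Type*} [Fintype σ] [DecidableEq σ] {m : σ → ℕ} {i : σ}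
    (hi : 1 ≤ m i) : ∑ s, (if s = i then m s - 1 else m s) + 1 = ∑ s, m s := by
  have h1 := Finset.add_sum_erase Finset.univ (fun s => if s = i then m s - 1 else m s)
    (Finset.mem_univ i)
  have h2 := Finset.add_sum_erase Finset.univ m (Finset.mem_univ i)
  have h3 : ∑ s ∈ Finset.univ.erase i, (if s = i then m s - 1 else m s) =
      ∑ s ∈ Finset.univ.erase i, m s :=
    Finset.sum_congr rfl fun s hs => if_neg (Finset.ne_of_mem_erase hs)
  simp only [if_true] at h1
  omega

variable {ℓ : ℕ} {k : Fin ℓ → ℕ} {p : ℕ}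

/-- Many disjoint connected sets on at least two vertices and of nonnegative excess over a
common set of hubs force the linear forest. -/
theorem containsLinearForest_of_dense_sets (hℓ : 2 ≤ ℓ) (hk : ∀ i, 2 ≤ k i)
    (hp : p + 1 = ∑ i, k i / 2) (hne3 : ∃ i, k i ≠ 3)
    {X : Finset V} {I : Finset ι} {D : ι → Finset V}
    (hdisj : ∀ i ∈ I, ∀ j ∈ I, i ≠ j → Disjoint (D i) (D j))
    (hX : ∀ i ∈ I, ∀ v ∈ D i, v ∉ X) (hconn : ∀ i ∈ I, CutConnected G (D i))
    (hhub : ∀ i ∈ I, ∀ x ∈ X, ∃ a ∈ D i, G.Adj x a)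
    (hcard : ∀ i ∈ I, 2 ≤ (D i).card) (hex : ∀ i ∈ I, 0 ≤ excess G p X (D i))
    (hdeg : ∀ i ∈ I, ∀ v ∈ D i, p + 1 ≤ degIn G (D i) v + degIn G X v)
    (hI : p + 1 + ℓ ≤ I.card) : ContainsLinearForest G k := by
  classical
  have hone : ∀ i, 1 ≤ k i / 2 := fun i => by have := hk i; omega
  have hsum : ∀ h : Fin ℓ → ℕ, ∑ i, h i ≤ p → ∑ i, (h i + 1) ≤ I.card := by
    intro h hh
    rw [Finset.sum_add_distrib, Finset.sum_const, Finset.card_univ, Fintype.card_fin, smul_eq_mul]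
    omega
  by_cases ht : p ≤ X.card
  · obtain ⟨s, hs⟩ := hne3
    have hone_le : ∀ i ∈ I, ∀ v ∈ D i, 1 ≤ degIn G (D i) v := by
      intro i hi v hv
      obtain ⟨a, ha, b, hb, -, hab⟩ := hconn i hi {v} (by simpa using hv) (by simp) (by
        intro h
        have := hcard i hi
        rw [← h] at this
        simp at this)
      rw [Finset.mem_singleton] at ha
      exact degIn_pos_iff.2 ⟨b, hb, ha ▸ hab⟩
    have hS : IsHubSystem G X I D (1 + 1) 2 := by
      refine isHubSystem_of_cutConnected hdisj hX hconn hhub hone_le fun i hi => ?_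
      obtain ⟨a, ha⟩ := Finset.card_pos.1 (by have := hcard i hi; omega : 0 < (D i).card)
      obtain ⟨L, hL, hlen, hLD⟩ := exists_path_of_degIn (hone_le i hi) ha
      exact ⟨a :: L, hL, hLD, by simp [hlen]⟩
    have hh := sum_sub_single_add_one (m := fun i => k i / 2) (hone s)
    refine hS.containsLinearForest (h := fun i => if i = s then k i / 2 - 1 else k i / 2)
      (by omega) (hsum _ (by omega)) fun i => ?_
    have := hk i
    split_ifs with his
    · subst his
      omega
    · omega
  · push Not at ht
    obtain ⟨r, hr⟩ : ∃ r, r + X.card = p := ⟨p - X.card, by omega⟩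
    have hS : IsHubSystem G X I D (r + 1) (2 * r + 1) := by
      have hdeg' : ∀ i ∈ I, ∀ v ∈ D i, r ≤ degIn G (D i) v := by
        intro i hi v hv
        have h1 := hdeg i hi v hv
        have h2 := degIn_le_card (G := G) X v
        omega
      refine isHubSystem_of_cutConnected hdisj hX hconn hhub hdeg' fun i hi => ?_
      have hlarge : 2 * r + 1 ≤ (D i).card := by
        by_contra! hlt
        refine absurd (hex i hi) (not_le.2 (Finset.sum_neg' (fun v hv => ?_) ?_))
        · have h1 := degIn_lt_card (G := G) hv
          have h2 := degIn_le_card (G := G) X v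
          omega
        · obtain ⟨v, hv⟩ := Finset.card_pos.1 (by have := hcard i hi; omega : 0 < (D i).card)
          refine ⟨v, hv, ?_⟩
          have h1 := degIn_lt_card (G := G) hv
          have h2 := degIn_le_card (G := G) X v
          omega
      obtain ⟨L, hL, hlen, hLD⟩ := (hconn i hi).exists_long_path (hdeg' i hi) hlarge
      exact ⟨L, hL, hLD, hlen⟩
    have : Nontrivial (Fin ℓ) := Fin.nontrivial_iff_two_le.2 hℓ
    have hle := sum_half_sub_le hone hp (r := r) (by omega)
    refine hS.containsLinearForest (h := fun i => k i / 2 - r) (by omega)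
      (hsum _ (by omega)) fun i => ?_
    have := hk i
    omega

/-- The number of sets in a dense family that guarantees `M` common neighbours. -/
def familySize (d M : ℕ) : ℕ := 2 ^ d * 2 * M

/-- A large graph with about `p` edges per vertex that does not contain the linear forest has
`p` vertices with many common neighbours. -/
theorem exists_common_neighbours [Fintype V] (hℓ : 2 ≤ ℓ) (hk : ∀ i, 2 ≤ k i)
    (hp : p + 1 = ∑ i, k i / 2) (hne3 : ∃ i, k i ≠ 3) (hfree : ¬ ContainsLinearForest G k)
    {M c d : ℕ} (hM : p + 1 + ℓ ≤ M) (hd : d = ∑ i, k i)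
    (hex : -(c : ℤ) ≤ excess G p ∅ Finset.univ)
    (hcard : (depthCoeff (familySize d M) d d).1 * c +
      (depthCoeff (familySize d M) d d).2 * familySize d M < Fintype.card V) :
    ∃ U W : Finset V, U.card = p ∧ M ≤ W.card ∧ ∀ w ∈ W, ∀ u ∈ U, G.Adj w u := by
  have hpath : ∀ L : List V, IsPathList G L → L.length ≤ d := by
    intro L hL
    by_contra! h
    exact hfree (containsLinearForest_of_long_path hL (hd ▸ h.le))
  obtain ⟨X, Y, hXd, hXY, F, hF, hFM⟩ := exists_denseFamily hpath hex hcard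
  choose! D hDsub hDne hDex hDconn hDdeg using fun C (hC : C ∈ F) =>
    exists_minimal_excess_nonneg (hF.nonempty C hC) (hF.excess_nonneg C hC)
  let code : Finset V → Finset V × Bool := fun C =>
    (X.filter fun x => ∃ a ∈ D C, G.Adj x a, decide ((D C).card = 1))
  obtain ⟨⟨Z, b⟩, -, hfib⟩ := Finset.exists_lt_card_fiber_of_mul_lt_card_of_maps_to
    (s := F) (t := X.powerset ×ˢ (Finset.univ : Finset Bool)) (f := code) (n := M)
    (fun C _ => by simp [code, em]) (by
      refine lt_of_le_of_lt ?_ hFM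
      rw [Finset.card_product, Finset.card_powerset, Finset.card_univ, Fintype.card_bool]
      exact Nat.mul_le_mul_right _ (Nat.mul_le_mul_right _ (Nat.pow_le_pow_right two_pos hXd)))
  set I := F.filter fun C => code C = (Z, b) with hI
  have hIF : ∀ C ∈ I, C ∈ F := fun C hC => (Finset.mem_filter.1 hC).1
  have hIcode : ∀ C ∈ I, (X.filter fun x => ∃ a ∈ D C, G.Adj x a) = Z ∧
      decide ((D C).card = 1) = b := fun C hC => Prod.ext_iff.1 (Finset.mem_filter.1 hC).2
  have hdisj : ∀ C ∈ I, ∀ C' ∈ I, C ≠ C' → Disjoint (D C) (D C') := fun C hC C' hC' hne =>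
    (hF.disjoint C (hIF C hC) C' (hIF C' hC') hne).mono (hDsub C (hIF C hC)) (hDsub C' (hIF C' hC'))
  have hdegZ : ∀ C ∈ I, ∀ v ∈ D C, degIn G X v = degIn G Z v := by
    intro C hC v hv
    rw [← (hIcode C hC).1]
    unfold degIn
    congr 1
    ext x
    simp only [Finset.mem_filter]
    exact ⟨fun h => ⟨⟨h.1, v, hv, h.2.symm⟩, h.2⟩, fun h => ⟨h.1.1, h.2⟩⟩
  have hexZ : ∀ C ∈ I, 0 ≤ excess G p Z (D C) := by
    intro C hC
    have h := hDex C (hIF C hC)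
    unfold excess at h ⊢
    rwa [Finset.sum_congr rfl fun v hv => by rw [← hdegZ C hC v hv]]
  cases b with
  | true =>
    have hone : ∀ C ∈ I, (D C).card = 1 := fun C hC => of_decide_eq_true (hIcode C hC).2
    have hW : ∀ C ∈ I, ∀ w ∈ D C, ∀ z ∈ Z, G.Adj w z := by
      intro C hC w hw z hz
      obtain ⟨v, hv⟩ := Finset.card_eq_one.1 (hone C hC)
      rw [← (hIcode C hC).1, Finset.mem_filter, hv] at hz
      rw [hv, Finset.mem_singleton] at hw
      obtain ⟨-, a, ha, hza⟩ := hz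
      rw [Finset.mem_singleton] at ha
      rw [hw, ← ha]
      exact hza.symm
    have hZcard : p ≤ Z.card := by
      obtain ⟨C, hC⟩ := Finset.card_pos.1 (by omega : 0 < I.card)
      obtain ⟨v, hv⟩ := Finset.card_eq_one.1 (hone C hC)
      have h1 := hexZ C hC
      rw [hv, excess_singleton] at h1
      have h2 := degIn_le_card (G := G) Z v
      omega
    obtain ⟨U, hUZ, hU⟩ := Finset.exists_subset_card_eq hZcard
    refine ⟨U, I.biUnion D, hU, ?_, ?_⟩
    · rw [Finset.card_biUnion hdisj, Finset.sum_congr rfl hone]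
      simpa using hfib.le
    · intro w hw u hu
      obtain ⟨C, hC, hwC⟩ := Finset.mem_biUnion.1 hw
      exact hW C hC w hwC u (hUZ hu)
  | false =>
    have htwo : ∀ C ∈ I, 2 ≤ (D C).card := by
      intro C hC
      have h1 := of_decide_eq_false (hIcode C hC).2
      have h2 := Finset.card_pos.2 (hDne C (hIF C hC))
      omega
    refine absurd (containsLinearForest_of_dense_sets hℓ hk hp hne3 hdisj ?_
      (fun C hC => hDconn C (hIF C hC)) ?_ htwo hexZ ?_ (by omega)) hfree
    · intro C hC v hv hvZ
      rw [← (hIcode C hC).1, Finset.mem_filter] at hvZ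
      exact Finset.disjoint_left.1 hXY hvZ.1 (hF.subset C (hIF C hC) (hDsub C (hIF C hC) hv))
    · intro C hC x hx
      rw [← (hIcode C hC).1, Finset.mem_filter] at hx
      exact hx.2
    · intro C hC v hv
      rw [← hdegZ C hC v hv]
      exact hDdeg C (hIF C hC) (htwo C hC) v hv

end CommonNeighbours

/-! ### The structure around the common neighbours -/

section Core

variable {G : SimpleGraph V} {ℓ : ℕ} {k : Fin ℓ → ℕ} {p : ℕ} {U W : Finset V}

/-- `U` consists of `p` vertices, and `W` is a large set of common neighbours of `U`. -/
structure IsCore (G : SimpleGraph V) (k : Fin ℓ → ℕ) (p : ℕ) (U W : Finset V) : Prop where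
  sum_half : p + 1 = ∑ i, k i / 2
  card_hubs : U.card = p
  adj : ∀ w ∈ W, ∀ u ∈ U, G.Adj w u
  card_common : p + 1 + ℓ + 2 * ∑ i, k i ≤ W.card

theorem IsCore.notMem (h : IsCore G k p U W) {w : V} (hw : w ∈ W) : w ∉ U :=
  fun hu => G.irrefl (h.adj w hw w hu)

theorem IsCore.isHubSystem (h : IsCore G k p U W) {X : Finset V} (hX : X ⊆ U) {I : Finset V}
    (hI : I ⊆ W) : IsHubSystem G X I (fun w => {w}) 1 1 where
  disjoint := by simp
  notMem := by
    intro i hi v hv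
    rw [Finset.mem_singleton] at hv
    exact fun hvX => h.notMem (hI hi) (hX (hv ▸ hvX))
  link := fun i hi x hx y hy => ⟨[i], .singleton G i, by simp, by simp,
    by simpa using (h.adj i (hI hi) x (hX hx)).symm, by simpa using h.adj i (hI hi) y (hX hy)⟩
  tail := fun i hi x hx => ⟨[i], .singleton G i, by simp, rfl,
    by simpa using (h.adj i (hI hi) x (hX hx)).symm⟩
  free := fun i _ => ⟨[i], .singleton G i, by simp, rfl⟩

theorem IsCore.half_le (h : IsCore G k p U W) (i : Fin ℓ) : k i / 2 ≤ p + 1 :=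
  h.sum_half ▸ Finset.single_le_sum (f := fun i => k i / 2) (fun _ _ => Nat.zero_le _)
    (Finset.mem_univ i)

theorem length_le_sum (i : Fin ℓ) : k i ≤ ∑ i, k i :=
  Finset.single_le_sum (f := k) (fun _ _ => Nat.zero_le _) (Finset.mem_univ i)

variable [DecidableEq V]

/-- A path on `k i` vertices that uses few vertices of `U` extends to the linear forest. -/
theorem IsCore.containsLinearForest_of_path (h : IsCore G k p U W) (hk : ∀ i, 2 ≤ k i)
    {i : Fin ℓ} {P : List V} (hP : IsPathList G P) (hlen : P.length = k i)
    (hU : (U.filter (· ∈ P)).card + 1 ≤ k i / 2) : ContainsLinearForest G k := by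
  have hsum := Finset.add_sum_erase Finset.univ (fun i => k i / 2) (Finset.mem_univ i)
  rw [← h.sum_half] at hsum
  have hcardU : (U.filter (· ∉ P)).card + (U.filter (· ∈ P)).card = p := by
    rw [← h.card_hubs, add_comm]
    exact Finset.card_filter_add_card_filter_not _
  have hcardW : W.card ≤ (W.filter (· ∉ P)).card + k i := by
    have h1 := Finset.card_filter_add_card_filter_not (s := W) (· ∈ P)
    have h2 : (W.filter (· ∈ P)).card ≤ P.toFinset.card :=
      Finset.card_le_card fun w hw => List.mem_toFinset.2 (Finset.mem_filter.1 hw).2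
    have h3 := P.toFinset_card_le
    omega
  have hki := length_le_sum (k := k) i
  have hcommon := h.card_common
  have hS := h.isHubSystem (Finset.filter_subset (· ∉ P) U) (Finset.filter_subset (· ∉ P) W)
  obtain ⟨L, hL, hdisj⟩ := hS.exists_disjoint_paths (k := k) (h := fun i => k i / 2)
    (Finset.univ.erase i) _ _ subset_rfl subset_rfl (by omega) (by
      have hle : ∑ s ∈ Finset.univ.erase i, (k s / 2 + 1) ≤ ∑ s, (k s / 2 + 1) :=
        Finset.sum_le_sum_of_subset (Finset.erase_subset _ _)
      rw [Finset.sum_add_distrib (s := Finset.univ), ← h.sum_half] at hle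
      simp only [Finset.sum_const, Finset.card_univ, Fintype.card_fin, smul_eq_mul, mul_one] at hle
      omega) (fun s _ => by have := hk s; omega)
  have hLP : ∀ s, s ≠ i → ∀ v ∈ L s, v ∉ P := by
    intro s hs v hv
    rcases (hL s (by simpa using hs)).2.2 v hv with hv | ⟨w, hw, hv⟩
    · exact (Finset.mem_filter.1 hv).2
    · rw [Finset.mem_singleton] at hv
      exact hv ▸ (Finset.mem_filter.1 hw).2
  refine containsLinearForest_of_lists (Function.update L i P) ?_ ?_ ?_
  · intro s
    rcases eq_or_ne s i with rfl | hs
    · rwa [Function.update_self]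
    · rw [Function.update_of_ne hs]
      exact (hL s (by simpa using hs)).1
  · intro s
    rcases eq_or_ne s i with rfl | hs
    · rwa [Function.update_self]
    · rw [Function.update_of_ne hs]
      exact (hL s (by simpa using hs)).2.1
  · intro s t hst v hv
    rcases eq_or_ne s i with rfl | hs
    · rw [Function.update_self] at hv
      rw [Function.update_of_ne hst.symm]
      exact fun hv' => hLP t hst.symm v hv' hv
    rw [Function.update_of_ne hs] at hv
    rcases eq_or_ne t i with rfl | ht
    · rw [Function.update_self]
      exact hLP s hs v hv
    · rw [Function.update_of_ne ht]
      exact hdisj s (by simpa using hs) t (by simpa using ht) hst v hv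

/-- Two paths outside `U`, the first ending next to some vertex of `U` and the second starting
next to every vertex of `U`, can be joined through `U`. -/
theorem IsCore.containsLinearForest_of_joined (h : IsCore G k p U W) (hk : ∀ i, 2 ≤ k i)
    {i : Fin ℓ} (hi : 4 ≤ k i) {A B : List V} (hA : IsPathList G A) (hB : IsPathList G B)
    (hAU : ∀ v ∈ A, v ∉ U) (hBU : ∀ v ∈ B, v ∉ U) (hAB : ∀ v ∈ A, v ∉ B) {u : V} (hu : u ∈ U)
    (hAu : ∀ a ∈ A.getLast?, G.Adj a u) (hUB : ∀ x ∈ U, ∀ b ∈ B.head?, G.Adj x b)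
    (hAlen : A.length + B.length ≤ k i)
    (hlen : k i + 3 ≤ A.length + B.length + 2 * (k i / 2)) : ContainsLinearForest G k := by
  have hhalf := h.half_le i
  obtain ⟨us, hus, huscard⟩ := Finset.exists_subset_card_eq
    (by rw [Finset.card_erase_of_mem hu, h.card_hubs]; omega : k i / 2 - 2 ≤ (U.erase u).card)
  set J := W.filter fun w => w ∉ A ∧ w ∉ B with hJ
  have hJcard : k i / 2 - 2 ≤ J.card := by
    have h1 : W.card ≤ (J ∪ (A ++ B).toFinset).card := by
      refine Finset.card_le_card fun w hw => ?_
      rw [Finset.mem_union, hJ, Finset.mem_filter, List.mem_toFinset, List.mem_append]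
      tauto
    have h2 := Finset.card_union_le J (A ++ B).toFinset
    have h3 := (A ++ B).toFinset_card_le
    rw [List.length_append] at h3
    have h4 := length_le_sum (k := k) i
    have h5 := h.card_common
    omega
  have hS := h.isHubSystem subset_rfl (Finset.filter_subset (fun w => w ∉ A ∧ w ∉ B) W)
  have hmem : ∀ v, v ∈ u :: us.toList ↔ v = u ∨ v ∈ us := by simp
  have husU : ∀ v ∈ u :: us.toList, v ∈ U := by
    intro v hv
    rcases (hmem v).1 hv with rfl | hv
    exacts [hu, Finset.mem_of_mem_erase (hus hv)]
  have hnd : (u :: us.toList).Nodup := by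
    refine List.nodup_cons.2 ⟨?_, Finset.nodup_toList us⟩
    rw [Finset.mem_toList]
    exact fun hmem => Finset.notMem_erase u U (hus hmem)
  obtain ⟨L, hL, hLlen, ⟨x, hx, hlast⟩, hreg⟩ := hS.exists_chain us.toList u J subset_rfl hnd
    husU (by rwa [Finset.length_toList, huscard])
  rw [Finset.length_toList, huscard] at hLlen
  have hLAB : ∀ v ∈ u :: L, v ∉ A ∧ v ∉ B := by
    intro v hv
    rcases hreg v hv with hv | ⟨w, hw, hv⟩
    · have hvU := husU v (List.mem_toFinset.1 hv)
      exact ⟨fun hvA => hAU v hvA hvU, fun hvB => hBU v hvB hvU⟩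
    · rw [Finset.mem_singleton] at hv
      exact hv ▸ (Finset.mem_filter.1 hw).2
  have hLB : IsPathList G ((u :: L) ++ B) := by
    refine hL.append hB (fun v hv => (hLAB v hv).2) ?_
    intro y hy z hz
    rw [hlast, Option.mem_some_iff] at hy
    exact hy ▸ hUB x hx z hz
  have hpath : IsPathList G (A ++ ((u :: L) ++ B)) := by
    refine hA.append hLB ?_ ?_
    · intro v hv hv'
      rcases List.mem_append.1 hv' with hv' | hv'
      exacts [(hLAB v hv').1 hv, hAB v hv hv']
    · intro y hy z hz
      simp only [List.cons_append, List.head?_cons, Option.mem_def, Option.some.injEq] at hz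
      exact hz ▸ hAu y hy
  refine h.containsLinearForest_of_path hk (i := i) (hpath.take (k i)) ?_ ?_
  · simp only [List.length_take, List.length_append, List.length_cons]
    omega
  · have hle : (U.filter (· ∈ (A ++ ((u :: L) ++ B)).take (k i))).card ≤ (insert u us).card := by
      refine Finset.card_le_card fun v hv => ?_
      obtain ⟨hvU, hv⟩ := Finset.mem_filter.1 hv
      have hv := List.mem_of_mem_take hv
      simp only [List.mem_append] at hv
      rcases hv with hv | hv | hv
      · exact absurd hvU (hAU v hv)
      · rcases hreg v hv with hv | ⟨w, hw, hv⟩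
        · exact Finset.mem_insert.2 ((hmem v).1 (List.mem_toFinset.1 hv))
        · rw [Finset.mem_singleton] at hv
          exact absurd hvU (hv ▸ h.notMem (Finset.mem_filter.1 hw).1)
      · exact absurd hvU (hBU v hv)
    have := Finset.card_insert_le u us
    omega

/-- A path outside `U` that ends next to a vertex of `U` can be prolonged through `U`. -/
theorem IsCore.containsLinearForest_of_attached (h : IsCore G k p U W) (hk : ∀ i, 2 ≤ k i)
    {i : Fin ℓ} (hi : 4 ≤ k i) {A : List V} (hA : IsPathList G A)
    (hAU : ∀ v ∈ A, v ∉ U) {u : V} (hu : u ∈ U)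
    (hAu : ∀ a ∈ A.getLast?, G.Adj a u) (hAlen : A.length + 1 ≤ k i)
    (hlen : k i + 2 ≤ A.length + 2 * (k i / 2)) : ContainsLinearForest G k := by
  obtain ⟨w, hw, hwA⟩ : ∃ w ∈ W, w ∉ A.toFinset := by
    refine Finset.exists_mem_notMem_of_card_lt_card ?_
    have h1 := A.toFinset_card_le
    have h2 := length_le_sum (k := k) i
    have h3 := h.card_common
    omega
  refine h.containsLinearForest_of_joined hk hi hA (.singleton G w) hAU ?_ ?_ hu hAu ?_
    (by simpa using hAlen) (by simp only [List.length_singleton]; omega)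
  · simpa using h.notMem hw
  · intro v hv hvw
    rw [List.mem_singleton] at hvw
    exact hwA (List.mem_toFinset.2 (hvw ▸ hv))
  · simpa using fun x hx => (h.adj w hw x hx).symm

end Core

/-! ### Counting edges outside the core -/

section Counting

variable {G : SimpleGraph V} {ℓ : ℕ} {k : Fin ℓ → ℕ} {p : ℕ} {U W : Finset V}

theorem IsPathList.pair {x y : V} (h : G.Adj x y) : IsPathList G [x, y] :=
  (IsPathList.singleton G y).cons (by simpa using h.ne) (by simpa using h)

theorem IsPathList.triple {x y z : V} (hxy : G.Adj x y) (hyz : G.Adj y z) (hxz : x ≠ z) :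
    IsPathList G [x, y, z] :=
  (IsPathList.pair hyz).cons (by simp [hxy.ne, hxz]) (by simpa using hxy)

theorem IsCore.card_le_add_one (h : IsCore G k p U W) (hk : ∀ i, 2 ≤ k i) :
    ℓ ≤ p + 1 := by
  rw [h.sum_half]
  calc ℓ = ∑ _i : Fin ℓ, 1 := by simp
    _ ≤ ∑ i, k i / 2 := Finset.sum_le_sum fun i _ => by have := hk i; omega

/-- A set without inner edges has nonpositive excess. -/
theorem excess_nonpos_of_independent {A : Finset V} (hU : U.card = p)
    (hA : ∀ v ∈ A, degIn G A v = 0) :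
    excess G p U A ≤ 0 ∧ (excess G p U A = 0 → ∀ v ∈ A, ∀ u ∈ U, G.Adj v u) := by
  have hterm : ∀ v ∈ A, (degIn G A v : ℤ) + 2 * degIn G U v - 2 * p ≤ 0 := by
    intro v hv
    have h1 := hA v hv
    have h2 := degIn_le_card (G := G) U v
    omega
  refine ⟨Finset.sum_nonpos hterm, fun heq v hv => degIn_eq_card_iff.1 ?_⟩
  have h1 := (Finset.sum_eq_zero_iff_of_nonpos hterm).1 heq v hv
  have h2 := hA v hv
  omega

variable [DecidableEq V]

theorem IsCore.not_adj_of_even (h : IsCore G k p U W) (hk : ∀ i, 2 ≤ k i)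
    (hfree : ¬ ContainsLinearForest G k) {i : Fin ℓ} (hi : Even (k i)) {x y u : V}
    (hx : x ∉ U) (hy : y ∉ U) (hu : u ∈ U) (hyu : G.Adj y u) : ¬ G.Adj x y := by
  intro hxy
  have hki := hk i
  obtain ⟨m, hm⟩ := hi
  have hU : ∀ v ∈ [x, y], v ∉ U := by simp [hx, hy]
  by_cases h2 : k i = 2
  · refine hfree (h.containsLinearForest_of_path hk (i := i) (.pair hxy) (by simp [h2]) ?_)
    rw [Finset.filter_eq_empty_iff.2 fun v hv hv' => hU v hv' hv, h2]
    simp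
  · exact hfree (h.containsLinearForest_of_attached hk (i := i) (by omega) (.pair hxy) hU hu
      (by simpa using hyu) (by simp only [List.length_cons, List.length_nil]; omega)
      (by simp only [List.length_cons, List.length_nil]; omega))

theorem IsCore.eq_of_adj_adj (h : IsCore G k p U W) (hk : ∀ i, 2 ≤ k i)
    (hfree : ¬ ContainsLinearForest G k) {i : Fin ℓ} (hi : 5 ≤ k i) {x y z u : V}
    (hx : x ∉ U) (hy : y ∉ U) (hz : z ∉ U) (hu : u ∈ U) (hzu : G.Adj z u)
    (hxy : G.Adj x y) (hyz : G.Adj y z) : x = z := by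
  by_contra hxz
  exact hfree (h.containsLinearForest_of_attached hk (i := i) (by omega)
    (.triple hxy hyz hxz) (by simp [hx, hy, hz]) hu (by simpa using hzu)
    (by simp only [List.length_cons, List.length_nil]; omega)
    (by simp only [List.length_cons, List.length_nil]; omega))

theorem IsCore.not_adj_of_disjoint_edge (h : IsCore G k p U W) (hk : ∀ i, 2 ≤ k i)
    (hfree : ¬ ContainsLinearForest G k) {i : Fin ℓ} (hi : 5 ≤ k i) {x y z t u : V}
    (hx : x ∉ U) (hy : y ∉ U) (hz : z ∉ U) (ht : t ∉ U) (hu : u ∈ U) (hzu : G.Adj z u)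
    (hyU : ∀ v ∈ U, G.Adj y v) (hxy : G.Adj x y) (hzx : z ≠ x) (hzy : z ≠ y) (htx : t ≠ x)
    (hty : t ≠ y) : ¬ G.Adj t z := by
  intro htz
  exact hfree (h.containsLinearForest_of_joined hk (i := i) (by omega)
    (.pair htz) (.pair hxy.symm) (by simp [hz, ht]) (by simp [hx, hy])
    (by simp [hzx, hzy, htx, hty]) hu (by simpa using hzu)
    (by simpa using fun v hv => (hyU v hv).symm)
    (by simp only [List.length_cons, List.length_nil]; omega)
    (by simp only [List.length_cons, List.length_nil]; omega))

theorem IsCore.length_lt_of_avoids (h : IsCore G k p U W) (hℓ : 2 ≤ ℓ) (hk : ∀ i, 2 ≤ k i)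
    (hfree : ¬ ContainsLinearForest G k) {L : List V} (hL : IsPathList G L)
    (hU : ∀ v ∈ L, v ∉ U) : L.length < p + 2 := by
  by_contra! hlen
  obtain ⟨i, hi⟩ : ∃ i, k i ≤ p + 2 := by
    have : Nontrivial (Fin ℓ) := Fin.nontrivial_iff_two_le.2 hℓ
    obtain ⟨i, j, hij⟩ := exists_pair_ne (Fin ℓ)
    have hle : ∑ s ∈ {i, j}, k s / 2 ≤ ∑ s, k s / 2 :=
      Finset.sum_le_sum_of_subset (Finset.subset_univ _)
    rw [Finset.sum_pair hij, ← h.sum_half] at hle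
    by_cases hij' : k i ≤ k j
    · exact ⟨i, by omega⟩
    · exact ⟨j, by omega⟩
  have hki := hk i
  refine hfree (h.containsLinearForest_of_path hk (i := i) (hL.take (k i)) ?_ ?_)
  · rw [List.length_take]
    omega
  · rw [Finset.filter_eq_empty_iff.2 fun v hv hv' => hU v (List.mem_of_mem_take hv') hv,
      Finset.card_empty]
    omega

/-- A set all of whose outgoing edges are pendant has negative excess, if it contains no
path on `p + 2` vertices. -/
theorem excess_neg_of_pendant {A B : Finset V} (hp : 1 ≤ p) (hdisj : Disjoint A B)
    (hB : B.Nonempty) (hdeg : ∀ v ∈ B, degIn G A v < p)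
    (hpend : ∀ v ∈ B, ∀ a ∈ A, G.Adj v a → ∀ w ∈ A ∪ B, G.Adj v w → w = a)
    (hpath : ∀ L, IsPathList G L → (∀ v ∈ L, v ∈ B) → L.length < p + 2) :
    excess G p A B < 0 := by
  by_contra! hex
  obtain ⟨D, hDB, ⟨a, ha⟩, hDex, -, hDdeg⟩ := exists_minimal_excess_nonneg hB hex
  by_cases hcard : 2 ≤ D.card
  · have hdegD : ∀ v ∈ D, p + 1 ≤ degIn G D v := by
      intro v hv
      have h1 := hDdeg hcard v hv
      suffices degIn G A v = 0 by omega
      by_contra hne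
      obtain ⟨b, hb, hvb⟩ := degIn_pos_iff.1 (Nat.pos_of_ne_zero hne)
      rw [← degIn_union (hdisj.mono_right hDB).symm] at h1
      obtain ⟨x, hx, y, hy, hvx, hvy, hxy⟩ :=
        one_lt_degIn_iff.1 (by omega : 1 < degIn G (D ∪ A) v)
      have hsub : D ∪ A ⊆ A ∪ B := by
        rw [Finset.union_comm]
        exact Finset.union_subset_union_right hDB
      exact hxy ((hpend v (hDB hv) b hb hvb x (hsub hx) hvx).trans
        (hpend v (hDB hv) b hb hvb y (hsub hy) hvy).symm)
    obtain ⟨L, hL, hlen, hLD⟩ := exists_path_of_degIn hdegD ha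
    have := hpath _ hL fun v hv => hDB (hLD v hv)
    rw [List.length_cons] at this
    omega
  · obtain ⟨v, rfl⟩ : ∃ v, D = {v} :=
      Finset.card_eq_one.1 (by have := Finset.card_pos.2 ⟨a, ha⟩; omega)
    rw [excess_singleton] at hDex
    have := hdeg v (hDB (Finset.mem_singleton_self v))
    omega

theorem excess_union_of_not_adj {A B : Finset V} (hdisj : Disjoint A B)
    (hB : ∀ v ∈ B, degIn G U v = 0) :
    excess G p U (A ∪ B) = excess G p U A + excess G p A B := by
  have hcomm : (∑ v ∈ A, (degIn G B v : ℤ)) = ∑ v ∈ B, (degIn G A v : ℤ) := by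
    exact_mod_cast sum_degIn_comm (G := G) A B
  unfold excess
  rw [Finset.sum_union hdisj,
    Finset.sum_congr (s₁ := B) rfl fun v hv => by rw [degIn_union hdisj, hB v hv],
    Finset.sum_congr (s₁ := A) rfl fun v hv => by rw [degIn_union hdisj]]
  push_cast
  simp only [Finset.sum_add_distrib, Finset.sum_sub_distrib, ← Finset.mul_sum]
  rw [hcomm, Finset.sum_const_zero]
  ring

/-- A set whose inner edges form a matching, in which an edge meeting a common neighbour of `U`
is the only edge, has excess at most two. -/
theorem excess_le_two_of_matching {A : Finset V} (hU : U.card = p)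
    (hmatch : ∀ v ∈ A, degIn G A v ≤ 1)
    (hsingle : ∀ x ∈ A, ∀ y ∈ A, G.Adj x y → (∀ u ∈ U, G.Adj y u) →
      ∀ z ∈ A, z ≠ x → z ≠ y → degIn G A z = 0) :
    excess G p U A ≤ 2 ∧ (excess G p U A = 2 → (∀ v ∈ A, ∀ u ∈ U, G.Adj v u) ∧
      ∃ x ∈ A, ∃ y ∈ A, G.Adj x y ∧ ∀ a ∈ A, ∀ b ∈ A, G.Adj a b →
        a = x ∧ b = y ∨ a = y ∧ b = x) := by
  by_cases hfull : ∃ x ∈ A, ∃ y ∈ A, G.Adj x y ∧ ∀ u ∈ U, G.Adj y u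
  · obtain ⟨x, hx, y, hy, hxy, hyU⟩ := hfull
    have hterm : ∀ v ∈ A, (degIn G A v : ℤ) + 2 * degIn G U v - 2 * p ≤
        if v ∈ ({x, y} : Finset V) then 1 else 0 := by
      intro v hv
      have h1 := hmatch v hv
      have h2 := degIn_le_card (G := G) U v
      split_ifs with hvxy
      · omega
      · simp only [Finset.mem_insert, Finset.mem_singleton, not_or] at hvxy
        have h3 := hsingle x hx y hy hxy hyU v hv hvxy.1 hvxy.2
        omega
    have hsum : ∑ v ∈ A, (if v ∈ ({x, y} : Finset V) then 1 else 0 : ℤ) = 2 := by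
      rw [← Finset.sum_filter, Finset.filter_mem_eq_inter,
        Finset.inter_eq_right.2 (by simp [Finset.insert_subset_iff, hx, hy]),
        Finset.sum_pair hxy.ne]
      norm_num
    refine ⟨hsum ▸ Finset.sum_le_sum hterm, fun heq => ?_⟩
    have htight := (Finset.sum_eq_sum_iff_of_le hterm).1 (heq.trans hsum.symm)
    refine ⟨fun v hv => degIn_eq_card_iff.1 ?_, x, hx, y, hy, hxy, ?_⟩
    · have h1 := hmatch v hv
      have h2 := degIn_le_card (G := G) U v
      have h3 := htight v hv
      split_ifs at h3 <;> omega
    · have hxy_only : ∀ v ∈ A, ∀ w ∈ A, ∀ w' ∈ A, G.Adj v w → G.Adj v w' → w = w' := by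
        intro v hv w hw w' hw' h h'
        by_contra hne
        have h1 := one_lt_degIn_iff.2 ⟨w, hw, w', hw', h, h', hne⟩
        have h2 := hmatch v hv
        omega
      intro a ha b hb hab
      have hpos : degIn G A a ≠ 0 := (degIn_pos_iff.2 ⟨b, hb, hab⟩).ne'
      by_cases hax : a = x
      · subst hax
        exact Or.inl ⟨rfl, hxy_only a ha b hb y hy hab hxy⟩
      · by_cases hay : a = y
        · subst hay
          exact Or.inr ⟨rfl, hxy_only a ha b hb x hx hab hxy.symm⟩
        · exact absurd (hsingle x hx y hy hxy hyU a ha hax hay) hpos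
  · push Not at hfull
    have hnonpos : excess G p U A ≤ 0 := by
      refine Finset.sum_nonpos fun v hv => ?_
      have h1 := hmatch v hv
      have h2 := degIn_le_card (G := G) U v
      by_cases h3 : degIn G A v = 0
      · omega
      · obtain ⟨x, hx, hvx⟩ := degIn_pos_iff.1 (Nat.pos_of_ne_zero h3)
        have h4 : degIn G U v ≠ U.card := by
          intro heq
          obtain ⟨u, hu, hvu⟩ := hfull x hx v hv hvx.symm
          exact hvu (degIn_eq_card_iff.1 heq u hu)
        omega
    exact ⟨by omega, fun heq => by omega⟩

end Counting

/-! ### The extremal graphs -/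

section Extremal

variable {G : SimpleGraph V} {ℓ : ℕ} {k : Fin ℓ → ℕ} {p : ℕ} {U W : Finset V}

/-- `G` consists of a clique on `T`, a clique on `U` joined to all other vertices, and
no further edges. -/
def IsCliqueJoin (G : SimpleGraph V) (U T : Finset V) : Prop :=
  ∀ a b, G.Adj a b ↔ a ≠ b ∧ (a ∈ U ∨ b ∈ U ∨ a ∈ T ∧ b ∈ T)

theorem exists_equiv_of_card_fiber {V' κ : Type*} [Finite V] [Finite V']
    (f : V → κ) (g : V' → κ) (h : ∀ c, Nat.card {v // f v = c} = Nat.card {v // g v = c}) :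
    ∃ e : V ≃ V', ∀ v, g (e v) = f v := by
  let e : ∀ c, {v // f v = c} ≃ {v // g v = c} := fun c => (Finite.card_eq.1 (h c)).some
  exact ⟨(Equiv.sigmaFiberEquiv f).symm.trans
    ((Equiv.sigmaCongrRight e).trans (Equiv.sigmaFiberEquiv g)), fun v => (e (f v) ⟨v, rfl⟩).2⟩

/-- The colouring of the vertices that distinguishes `U`, `T`, and the remaining vertices. -/
noncomputable def partColour (U T : Finset V) (v : V) : Fin 3 :=
  if v ∈ U then 0 else if v ∈ T then 1 else 2

theorem partColour_eq_zero_iff {U T : Finset V} {v : V} : partColour U T v = 0 ↔ v ∈ U := by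
  unfold partColour
  split_ifs <;> simp_all

theorem partColour_eq_one_iff {U T : Finset V} (h : Disjoint U T) {v : V} :
    partColour U T v = 1 ↔ v ∈ T := by
  have := @Finset.disjoint_left _ U T
  unfold partColour
  split_ifs <;> simp_all

theorem partColour_eq_two_iff {U T : Finset V} {v : V} :
    partColour U T v = 2 ↔ ¬ (v ∈ U ∨ v ∈ T) := by
  unfold partColour
  split_ifs <;> simp_all

theorem card_partColour_fiber [Fintype V] {U T : Finset V} (h : Disjoint U T) (c : Fin 3) :
    Nat.card {v // partColour U T v = c} =
      ![U.card, T.card, Fintype.card V - (U.card + T.card)] c := by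
  rw [Nat.card_eq_fintype_card, Fintype.card_subtype]
  match c with
  | 0 => simp [partColour_eq_zero_iff]
  | 1 => simp [partColour_eq_one_iff h]
  | 2 =>
    have hcompl : (Finset.univ.filter fun v => partColour U T v = 2) = (U ∪ T)ᶜ := by
      ext v
      simp [partColour_eq_two_iff]
    rw [hcompl, Finset.card_compl, Finset.card_union_of_disjoint h]
    rfl

/-- Two clique joins with parts of equal sizes are isomorphic. -/
theorem IsCliqueJoin.nonempty_iso {V' : Type*} [Fintype V] [Fintype V'] {H : SimpleGraph V'}
    {U T : Finset V} {U' T' : Finset V'} (hG : IsCliqueJoin G U T) (hH : IsCliqueJoin H U' T')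
    (hcard : Fintype.card V = Fintype.card V') (hdisj : Disjoint U T) (hdisj' : Disjoint U' T')
    (hU : U.card = U'.card) (hT : T.card = T'.card) : Nonempty (G ≃g H) := by
  obtain ⟨e, he⟩ := exists_equiv_of_card_fiber (partColour U T) (partColour U' T') fun c => by
    rw [card_partColour_fiber hdisj, card_partColour_fiber hdisj', hcard, hU, hT]
  have heU : ∀ v, e v ∈ U' ↔ v ∈ U := fun v => by
    rw [← partColour_eq_zero_iff (T := T'), he, partColour_eq_zero_iff]
  have heT : ∀ v, e v ∈ T' ↔ v ∈ T := fun v => by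
    rw [← partColour_eq_one_iff hdisj', he, partColour_eq_one_iff hdisj]
  refine ⟨⟨e, ?_⟩⟩
  intro a b
  rw [hG a b, hH, heU, heU, heT, heT, e.injective.ne_iff]

theorem isCliqueJoin_Snp (n p : ℕ) :
    IsCliqueJoin (Snp n p) (Finset.univ.filter fun i => i.val < p) ∅ := by
  intro a b
  simp only [Snp, SimpleGraph.fromRel_adj, Finset.mem_filter, Finset.mem_univ, true_and,
    Finset.notMem_empty, or_false, and_false]
  tauto

theorem isCliqueJoin_SnpPlus (n p : ℕ) :
    IsCliqueJoin (SnpPlus n p) (Finset.univ.filter fun i => i.val < p)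
      (Finset.univ.filter fun i => n - 2 ≤ i.val) := by
  intro a b
  simp only [SnpPlus, SimpleGraph.fromRel_adj, Finset.mem_filter, Finset.mem_univ, true_and]
  tauto

theorem card_filter_val_lt {n p : ℕ} (h : p ≤ n) :
    (Finset.univ.filter fun i : Fin n => i.val < p).card = p := by
  rw [Fin.card_filter_val_lt, min_eq_right h]

theorem card_filter_sub_two_le {n : ℕ} (h : 2 ≤ n) :
    (Finset.univ.filter fun i : Fin n => n - 2 ≤ i.val).card = 2 := by
  have h1 := Finset.card_filter_add_card_filter_not (s := Finset.univ)
    (fun i : Fin n => i.val < n - 2)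
  simp only [not_lt, Finset.card_univ, Fintype.card_fin] at h1
  rw [card_filter_val_lt (Nat.sub_le n 2)] at h1
  omega

theorem two_mul_choose_two (p : ℕ) : 2 * p.choose 2 = p * (p - 1) := by
  rw [Nat.choose_two_right, Nat.two_mul_div_two_of_even (Nat.even_mul_pred_self p)]

variable [DecidableEq V]

/-- The doubled number of edges, split according to the vertices in `U` and outside `U`. -/
theorem two_mul_card_edgeSet [Fintype V] (p : ℕ) (U : Finset V) :
    (2 * Nat.card G.edgeSet : ℤ) =
      (∑ v ∈ U, degIn G U v : ℕ) + 2 * p * (Uᶜ.card : ℤ) + excess G p U Uᶜ := by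
  have h1 : 2 * Nat.card G.edgeSet = ∑ v, degIn G Finset.univ v := by
    rw [Nat.card_eq_fintype_card, ← SimpleGraph.edgeFinset_card,
      ← SimpleGraph.sum_degrees_eq_twice_card_edges]
    refine Finset.sum_congr rfl fun v _ => ?_
    rw [degIn, ← SimpleGraph.card_neighborFinset_eq_degree, SimpleGraph.neighborFinset_eq_filter]
  have h2 : ∑ v, degIn G Finset.univ v = ∑ v ∈ U, degIn G U v +
      (∑ v ∈ Uᶜ, degIn G Uᶜ v + 2 * ∑ v ∈ Uᶜ, degIn G U v) := by
    rw [← Finset.sum_add_sum_compl U]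
    simp only [← Finset.union_compl U, degIn_union (disjoint_compl_right (a := U))]
    rw [Finset.sum_add_distrib, Finset.sum_add_distrib, sum_degIn_comm U Uᶜ]
    ring
  have h3 : (2 * Nat.card G.edgeSet : ℤ) = (∑ v ∈ U, degIn G U v : ℕ) +
      ((∑ v ∈ Uᶜ, degIn G Uᶜ v : ℕ) + 2 * (∑ v ∈ Uᶜ, degIn G U v : ℕ)) := by
    exact_mod_cast h1.trans h2
  rw [h3, excess]
  simp only [Finset.sum_add_distrib, Finset.sum_sub_distrib, ← Finset.mul_sum, Finset.sum_const,
    nsmul_eq_mul]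
  push_cast
  ring

theorem sum_degIn_self_le (hU : U.card = p) :
    ∑ v ∈ U, degIn G U v ≤ p * (p - 1) ∧
      (∑ v ∈ U, degIn G U v = p * (p - 1) ↔ ∀ v ∈ U, ∀ w ∈ U, v ≠ w → G.Adj v w) := by
  have hterm : ∀ v ∈ U, degIn G U v ≤ p - 1 := fun v hv => by
    have := degIn_lt_card (G := G) hv
    omega
  have hsum : ∑ _v ∈ U, (p - 1) = p * (p - 1) := by rw [Finset.sum_const, hU, smul_eq_mul]
  refine ⟨hsum ▸ Finset.sum_le_sum hterm, ?_⟩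
  rw [← hsum, Finset.sum_eq_sum_iff_of_le hterm]
  refine forall₂_congr fun v hv => ?_
  rw [← degIn_erase_self, ← hU, ← Finset.card_erase_of_mem hv, degIn_eq_card_iff]
  simp only [Finset.mem_erase, ne_eq, and_imp]
  exact ⟨fun h w hw hvw => h w (Ne.symm hvw) hw, fun h w hvw hw => h w hw (Ne.symm hvw)⟩

theorem IsCliqueJoin.two_mul_card_edgeSet [Fintype V] {T : Finset V} (h : IsCliqueJoin G U T)
    (hU : U.card = p) (hdisj : Disjoint U T) :
    2 * Nat.card G.edgeSet =
      p * (p - 1) + 2 * p * (Fintype.card V - p) + T.card * (T.card - 1) := by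
  have hT : ∀ v ∈ Uᶜ, degIn G Uᶜ v = if v ∈ T then T.card - 1 else 0 := by
    intro v hv
    rw [Finset.mem_compl] at hv
    split_ifs with hvT
    · rw [← Finset.card_erase_of_mem hvT, degIn]
      congr 1
      ext w
      simp only [Finset.mem_filter, Finset.mem_compl, Finset.mem_erase, h v w]
      have := @Finset.disjoint_left _ U T
      grind
    · rw [degIn_eq_zero_iff]
      intro w hw
      rw [Finset.mem_compl] at hw
      rw [h v w]
      tauto
  have hUc : ∀ v ∈ Uᶜ, degIn G U v = p := by
    intro v hv
    rw [Finset.mem_compl] at hv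
    rw [← hU, degIn_eq_card_iff]
    intro w hw
    rw [h v w]
    exact ⟨fun hvw => hv (hvw ▸ hw), Or.inr (Or.inl hw)⟩
  have hex : excess G p U Uᶜ = (T.card * (T.card - 1) : ℕ) := by
    have hsub : T ⊆ Uᶜ := fun v hv =>
      Finset.mem_compl.2 fun hvU => Finset.disjoint_left.1 hdisj hvU hv
    rw [excess, Finset.sum_congr rfl fun v hv => by rw [hUc v hv, hT v hv]]
    have hsum : ∑ v ∈ Uᶜ, (if v ∈ T then T.card - 1 else 0) = T.card * (T.card - 1) := by
      rw [← Finset.sum_filter, Finset.filter_mem_eq_inter, Finset.inter_eq_right.2 hsub,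
        Finset.sum_const, smul_eq_mul]
    rw [← hsum, Nat.cast_sum]
    exact Finset.sum_congr rfl fun v _ => by ring
  have hclique := (sum_degIn_self_le (G := G) hU).2.2 fun v hv w _ hvw =>
    (h v w).2 ⟨hvw, Or.inl hv⟩
  have hcount := LinearForest.two_mul_card_edgeSet (G := G) p U
  rw [hclique, hex, Finset.card_compl, hU] at hcount
  exact_mod_cast hcount

end Extremal

section Outside

variable {G : SimpleGraph V} {ℓ : ℕ} {k : Fin ℓ → ℕ} {p : ℕ} {U W : Finset V} [DecidableEq V]
  [Fintype V]

/-- The excess outside `U` is at most the excess of the set of vertices outside `U` that are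
adjacent to `U`, with equality only if every vertex outside `U` is adjacent to `U`. -/
theorem IsCore.excess_compl_le (h : IsCore G k p U W) (hℓ : 2 ≤ ℓ) (hk : ∀ i, 2 ≤ k i)
    (hfree : ¬ ContainsLinearForest G k)
    (hdeg : ∀ v ∉ U, degIn G (Uᶜ.filter fun v => 0 < degIn G U v) v < p)
    (hpend : ∀ x y z u, x ∉ U → y ∉ U → z ∉ U → u ∈ U → G.Adj z u → G.Adj x y → G.Adj y z →
      x = z) :
    excess G p U Uᶜ ≤ excess G p U (Uᶜ.filter fun v => 0 < degIn G U v) ∧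
      (excess G p U Uᶜ = excess G p U (Uᶜ.filter fun v => 0 < degIn G U v) →
        (Uᶜ.filter fun v => 0 < degIn G U v) = Uᶜ) := by
  set A := Uᶜ.filter fun v => 0 < degIn G U v with hA
  set B := Uᶜ.filter fun v => ¬ 0 < degIn G U v with hB
  have hdisj : Disjoint A B := Finset.disjoint_filter_filter_not _ _ _
  have hunion : A ∪ B = Uᶜ := Finset.filter_union_filter_not_eq _ _
  have hsplit := excess_union_of_not_adj (G := G) (p := p) (U := U) hdisj
    fun v hv => by have := (Finset.mem_filter.1 hv).2; omega
  rw [hunion] at hsplit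
  have hAU : ∀ v ∈ A, v ∉ U := fun v hv => Finset.mem_compl.1 (Finset.mem_filter.1 hv).1
  have hBU : ∀ v ∈ B, v ∉ U := fun v hv => Finset.mem_compl.1 (Finset.mem_filter.1 hv).1
  rcases B.eq_empty_or_nonempty with hBe | hBne
  · rw [hBe, Finset.union_empty] at hunion
    rw [hunion]
    exact ⟨le_rfl, fun _ => rfl⟩
  · have hp := h.card_le_add_one hk
    have hneg : excess G p A B < 0 := by
      refine excess_neg_of_pendant (by omega) hdisj hBne (fun v hv => hdeg v (hBU v hv)) ?_ ?_
      · intro v hv a ha hva w hw hvw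
        obtain ⟨u, hu, hau⟩ := degIn_pos_iff.1 (Finset.mem_filter.1 ha).2
        refine hpend w v a u ?_ (hBU v hv) (hAU a ha) hu hau hvw.symm hva
        rw [hunion] at hw
        exact Finset.mem_compl.1 hw
      · exact fun L hL hLB => h.length_lt_of_avoids hℓ hk hfree hL fun v hv => hBU v (hLB v hv)
    exact ⟨by omega, fun heq => by omega⟩

/-- The outside of the core when some path has an even number of vertices. -/
theorem IsCore.outside_of_even (h : IsCore G k p U W) (hℓ : 2 ≤ ℓ) (hk : ∀ i, 2 ≤ k i)
    (hfree : ¬ ContainsLinearForest G k) {i : Fin ℓ} (hi : Even (k i)) :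
    excess G p U Uᶜ ≤ 0 ∧ (excess G p U Uᶜ = 0 →
      (∀ v ∉ U, ∀ u ∈ U, G.Adj v u) ∧ ∀ v ∉ U, ∀ w ∉ U, ¬ G.Adj v w) := by
  have hA : ∀ v ∉ U, degIn G (Uᶜ.filter fun v => 0 < degIn G U v) v = 0 := by
    intro v hv
    rw [degIn_eq_zero_iff]
    intro w hw
    obtain ⟨hwU, hwpos⟩ := Finset.mem_filter.1 hw
    obtain ⟨u, hu, hwu⟩ := degIn_pos_iff.1 hwpos
    exact h.not_adj_of_even hk hfree hi hv (Finset.mem_compl.1 hwU) hu hwu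
  have hp := h.card_le_add_one hk
  obtain ⟨hle, heq⟩ := h.excess_compl_le hℓ hk hfree (fun v hv => by rw [hA v hv]; omega)
    fun x y z u hx hy hz hu hzu hxy hyz =>
      absurd hyz (h.not_adj_of_even hk hfree hi hy hz hu hzu)
  obtain ⟨hle', heq'⟩ := excess_nonpos_of_independent (G := G) h.card_hubs
    fun v hv => hA v (Finset.mem_compl.1 (Finset.mem_filter.1 hv).1)
  refine ⟨hle.trans hle', fun h0 => ?_⟩
  have hall := heq (by omega)
  rw [hall] at hA heq'
  refine ⟨fun v hv => heq' h0 v (Finset.mem_compl.2 hv), fun v hv w hw => ?_⟩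
  exact degIn_eq_zero_iff.1 (hA v hv) w (Finset.mem_compl.2 hw)

/-- The outside of the core when some path has an odd number, at least five, of vertices. -/
theorem IsCore.outside_of_five_le (h : IsCore G k p U W) (hℓ : 2 ≤ ℓ) (hk : ∀ i, 2 ≤ k i)
    (hfree : ¬ ContainsLinearForest G k) {i : Fin ℓ} (hi : 5 ≤ k i) :
    excess G p U Uᶜ ≤ 2 ∧ (excess G p U Uᶜ = 2 → (∀ v ∉ U, ∀ u ∈ U, G.Adj v u) ∧
      ∃ x ∉ U, ∃ y ∉ U, G.Adj x y ∧ ∀ a ∉ U, ∀ b ∉ U, G.Adj a b →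
        a = x ∧ b = y ∨ a = y ∧ b = x) := by
  have hmem : ∀ v ∈ Uᶜ.filter fun v => 0 < degIn G U v, v ∉ U ∧ ∃ u ∈ U, G.Adj v u :=
    fun v hv => ⟨Finset.mem_compl.1 (Finset.mem_filter.1 hv).1,
      degIn_pos_iff.1 (Finset.mem_filter.1 hv).2⟩
  have hmatch : ∀ v ∉ U, degIn G (Uᶜ.filter fun v => 0 < degIn G U v) v ≤ 1 := by
    intro v hv
    by_contra! hlt
    obtain ⟨a, ha, b, hb, hva, hvb, hab⟩ := one_lt_degIn_iff.1 hlt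
    obtain ⟨hbU, u, hu, hbu⟩ := hmem b hb
    exact hab (h.eq_of_adj_adj hk hfree hi (hmem a ha).1 hv hbU hu hbu hva.symm hvb)
  have hp : 2 ≤ p := by
    have : Nontrivial (Fin ℓ) := Fin.nontrivial_iff_two_le.2 hℓ
    obtain ⟨j, hj⟩ := exists_ne i
    have hle : ∑ s ∈ {i, j}, k s / 2 ≤ ∑ s, k s / 2 :=
      Finset.sum_le_sum_of_subset (Finset.subset_univ _)
    rw [Finset.sum_pair hj.symm, ← h.sum_half] at hle
    have := hk j
    omega
  obtain ⟨hle, heq⟩ := h.excess_compl_le hℓ hk hfree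
    (fun v hv => by have := hmatch v hv; omega)
    fun x y z u hx hy hz hu hzu hxy hyz => h.eq_of_adj_adj hk hfree hi hx hy hz hu hzu hxy hyz
  obtain ⟨hle', heq'⟩ := excess_le_two_of_matching (G := G) h.card_hubs
    (A := Uᶜ.filter fun v => 0 < degIn G U v) (fun v hv => hmatch v (hmem v hv).1) (by
      intro x hx y hy hxy hyU z hz hzx hzy
      obtain ⟨hzU, u, hu, hzu⟩ := hmem z hz
      obtain ⟨hxU, ux, hux, hxux⟩ := hmem x hx
      obtain ⟨hyU', uy, huy, hyuy⟩ := hmem y hy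
      rw [degIn_eq_zero_iff]
      intro t ht hzt
      obtain ⟨htU, -⟩ := hmem t ht
      by_cases htx : t = x
      · subst htx
        exact hzy (h.eq_of_adj_adj hk hfree hi hzU hxU hyU' huy hyuy hzt hxy)
      by_cases hty : t = y
      · subst hty
        exact hzx (h.eq_of_adj_adj hk hfree hi hzU hyU' hxU hux hxux hzt hxy.symm)
      exact h.not_adj_of_disjoint_edge hk hfree hi hxU hyU' hzU htU hu hzu hyU hxy hzx hzy
        htx hty hzt.symm)
  refine ⟨hle.trans hle', fun h2 => ?_⟩
  have hall := heq (by omega)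
  rw [hall] at heq'
  simpa only [Finset.mem_compl] using heq' h2

/-- If the outside of `U` has excess at most `2 c`, then `G` has at most the extremal number of
edges, and it is a clique join in the case of equality. -/
theorem card_edgeSet_le_of_excess_le {c : ℕ} (hU : U.card = p) (hle : excess G p U Uᶜ ≤ 2 * c)
    (heq : excess G p U Uᶜ = 2 * c → ∃ T, T.card = 2 * c ∧ Disjoint U T ∧
      (∀ v ∉ U, ∀ u ∈ U, G.Adj v u) ∧
      ∀ v ∉ U, ∀ w ∉ U, G.Adj v w ↔ v ≠ w ∧ v ∈ T ∧ w ∈ T) :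
    Nat.card G.edgeSet ≤ p.choose 2 + p * (Fintype.card V - p) + c ∧
      (Nat.card G.edgeSet = p.choose 2 + p * (Fintype.card V - p) + c →
        ∃ T, T.card = 2 * c ∧ Disjoint U T ∧ IsCliqueJoin G U T) := by
  have hcount := two_mul_card_edgeSet (G := G) p U
  obtain ⟨hUle, hUeq⟩ := sum_degIn_self_le (G := G) hU
  have hchoose := two_mul_choose_two p
  rw [Finset.card_compl, hU] at hcount
  have hprod : (2 * p * ((Fintype.card V - p : ℕ) : ℤ)) =
      2 * (p * (Fintype.card V - p) : ℕ) := by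
    push_cast
    ring
  rw [hprod] at hcount
  refine ⟨by omega, fun he => ?_⟩
  obtain ⟨T, hT, hdisj, hfull, hadj⟩ := heq (by omega)
  refine ⟨T, hT, hdisj, fun a b => ?_⟩
  have hclique := hUeq.1 (by omega)
  by_cases ha : a ∈ U
  · by_cases hb : b ∈ U
    · exact ⟨fun hab => ⟨hab.ne, Or.inl ha⟩, fun hab => hclique a ha b hb hab.1⟩
    · exact ⟨fun hab => ⟨hab.ne, Or.inl ha⟩, fun _ => (hfull b hb a ha).symm⟩
  · by_cases hb : b ∈ U
    · exact ⟨fun hab => ⟨hab.ne, Or.inr (Or.inl hb)⟩, fun _ => hfull a ha b hb⟩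
    · rw [hadj a ha b hb]
      tauto

/-- The extremal bound for a graph with a core. -/
theorem IsCore.card_edgeSet_le (h : IsCore G k p U W) (hℓ : 2 ≤ ℓ) (hk : ∀ i, 2 ≤ k i)
    (hfree : ¬ ContainsLinearForest G k) (hne3 : ∃ i, k i ≠ 3) {c : ℕ}
    (hc1 : (∀ i, Odd (k i)) → c = 1) (hc0 : (¬ ∀ i, Odd (k i)) → c = 0) :
    Nat.card G.edgeSet ≤ p.choose 2 + p * (Fintype.card V - p) + c ∧
      (Nat.card G.edgeSet = p.choose 2 + p * (Fintype.card V - p) + c →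
        ∃ T, T.card = 2 * c ∧ Disjoint U T ∧ IsCliqueJoin G U T) := by
  by_cases hodd : ∀ i, Odd (k i)
  · obtain rfl := hc1 hodd
    obtain ⟨i, hi⟩ := hne3
    obtain ⟨m, hm⟩ := hodd i
    have hki := hk i
    obtain ⟨hle, heq⟩ := h.outside_of_five_le hℓ hk hfree (i := i) (by omega)
    refine card_edgeSet_le_of_excess_le h.card_hubs (by simpa using hle) fun h2 => ?_
    obtain ⟨hfull, x, hx, y, hy, hxy, honly⟩ := heq (by simpa using h2)
    refine ⟨{x, y}, Finset.card_pair hxy.ne, by simp [hx, hy], hfull, fun v hv w hw => ?_⟩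
    simp only [Finset.mem_insert, Finset.mem_singleton]
    constructor
    · intro hvw
      have := honly v hv w hw hvw
      exact ⟨hvw.ne, by tauto, by tauto⟩
    · rintro ⟨hvw, rfl | rfl, rfl | rfl⟩
      exacts [absurd rfl hvw, hxy, hxy.symm, absurd rfl hvw]
  · obtain rfl := hc0 hodd
    obtain ⟨i, hi⟩ := not_forall.1 hodd
    obtain ⟨hle, heq⟩ := h.outside_of_even hℓ hk hfree (Nat.not_odd_iff_even.1 hi)
    refine card_edgeSet_le_of_excess_le h.card_hubs (by simpa using hle) fun h0 => ?_
    obtain ⟨hfull, hno⟩ := heq (by simpa using h0)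
    exact ⟨∅, rfl, by simp, hfull, fun v hv w hw => by simpa using hno v hv w hw⟩

/-- The order beyond which the extremal bound is proved. -/
def orderThreshold (ℓ p d : ℕ) : ℕ :=
  (depthCoeff (familySize d (p + 1 + ℓ + 2 * d)) d d).1 * (2 * p * p) +
    (depthCoeff (familySize d (p + 1 + ℓ + 2 * d)) d d).2 *
      familySize d (p + 1 + ℓ + 2 * d) + p + 3

theorem exists_isCore (hℓ : 2 ≤ ℓ) (hk : ∀ i, 2 ≤ k i) (hp : p + 1 = ∑ i, k i / 2)
    (hne3 : ∃ i, k i ≠ 3) (hfree : ¬ ContainsLinearForest G k)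
    (hcard : orderThreshold ℓ p (∑ i, k i) ≤ Fintype.card V)
    (hedges : p.choose 2 + p * (Fintype.card V - p) ≤ Nat.card G.edgeSet) :
    ∃ U W, IsCore G k p U W := by
  unfold orderThreshold at hcard
  obtain ⟨U, W, hU, hW, hadj⟩ := exists_common_neighbours (M := p + 1 + ℓ + 2 * ∑ i, k i)
    (c := 2 * p * p) hℓ hk hp hne3 hfree (by omega) rfl (by
      have hcount := two_mul_card_edgeSet (G := G) p ∅
      rw [Finset.sum_empty, Finset.compl_empty, Finset.card_univ] at hcount
      obtain ⟨r, hr⟩ : ∃ r, Fintype.card V = p + r := ⟨Fintype.card V - p, by omega⟩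
      rw [hr, Nat.add_sub_cancel_left] at hedges
      rw [hr] at hcount
      zify at hedges
      push_cast at hcount ⊢
      have : (0 : ℤ) ≤ p.choose 2 := Nat.cast_nonneg _
      nlinarith) (by omega)
  exact ⟨U, W, hp, hU, hadj, hW⟩

/-- A graph isomorphic to a clique join has the extremal number of edges. -/
theorem card_edgeSet_of_iso {n c : ℕ} {G H : SimpleGraph (Fin n)} (e : G ≃g H)
    {U T : Finset (Fin n)} (hH : IsCliqueJoin H U T) (hU : U.card = p) (hdisj : Disjoint U T)
    (hT : T.card = 2 * c) (hc : c ≤ 1) :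
    Nat.card G.edgeSet = p.choose 2 + p * (n - p) + c := by
  rw [Nat.card_congr e.mapEdgeSet]
  have hcount := hH.two_mul_card_edgeSet hU hdisj
  have hchoose := two_mul_choose_two p
  rw [hT, Fintype.card_fin, mul_assoc 2 p] at hcount
  interval_cases c <;> omega

end Outside

end LinearForest

open LinearForest

theorem turan_number_linearForest (ℓ : ℕ) (hℓ : 2 ≤ ℓ) (k : Fin ℓ → ℕ)
    (hk : ∀ i, 2 ≤ k i) (hmono : Antitone k)
    (p : ℕ) (hp : p + 1 = ∑ i, k i / 2)
    (hne3 : ∃ i, k i ≠ 3)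
    (c : ℕ) (hc1 : (∀ i, Odd (k i)) → c = 1) (hc0 : (¬ ∀ i, Odd (k i)) → c = 0) :
    ∃ N : ℕ, ∀ n : ℕ, N ≤ n → ∀ G : SimpleGraph (Fin n), ¬ ContainsLinearForest G k →
      Nat.card G.edgeSet ≤ p.choose 2 + p * (n - p) + c ∧
      (c = 1 →
        (Nat.card G.edgeSet = p.choose 2 + p * (n - p) + c ↔ Nonempty (G ≃g SnpPlus n p))) ∧
      (c = 0 →
        (Nat.card G.edgeSet = p.choose 2 + p * (n - p) + c ↔ Nonempty (G ≃g Snp n p))) := by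
  refine ⟨orderThreshold ℓ p (∑ i, k i), fun n hn G hfree => ?_⟩
  have hpn : p + 2 ≤ n := by
    unfold orderThreshold at hn
    omega
  have hc : c ≤ 1 := by
    by_cases hodd : ∀ i, Odd (k i)
    · exact (hc1 hodd).le
    · exact (hc0 hodd).le.trans zero_le_one
  have hUcard := card_filter_val_lt (n := n) (p := p) (by omega)
  have hTcard := card_filter_sub_two_le (n := n) (by omega)
  have hdisj : Disjoint (Finset.univ.filter fun i : Fin n => i.val < p)
      (Finset.univ.filter fun i : Fin n => n - 2 ≤ i.val) :=
    Finset.disjoint_filter.2 fun i _ h1 h2 => by omega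
  have key : Nat.card G.edgeSet ≤ p.choose 2 + p * (n - p) + c ∧
      (Nat.card G.edgeSet = p.choose 2 + p * (n - p) + c →
        ∃ U T : Finset (Fin n), U.card = p ∧ T.card = 2 * c ∧ Disjoint U T ∧
          IsCliqueJoin G U T) := by
    by_cases hedges : p.choose 2 + p * (n - p) ≤ Nat.card G.edgeSet
    · obtain ⟨U, W, hcore⟩ := exists_isCore (G := G) hℓ hk hp hne3 hfree
        (by rwa [Fintype.card_fin]) (by rwa [Fintype.card_fin])
      obtain ⟨hle, heq⟩ := hcore.card_edgeSet_le hℓ hk hfree hne3 hc1 hc0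
      rw [Fintype.card_fin] at hle heq
      refine ⟨hle, fun he => ?_⟩
      obtain ⟨T, hT⟩ := heq he
      exact ⟨U, T, hcore.card_hubs, hT⟩
    · exact ⟨by omega, fun he => by omega⟩
  refine ⟨key.1, ?_, ?_⟩
  · rintro rfl
    refine ⟨fun he => ?_, fun ⟨e⟩ =>
      card_edgeSet_of_iso e (isCliqueJoin_SnpPlus n p) hUcard hdisj hTcard hc⟩
    obtain ⟨U, T, hU, hT, hUT, hjoin⟩ := key.2 he
    exact hjoin.nonempty_iso (isCliqueJoin_SnpPlus n p) rfl hUT hdisj (hU.trans hUcard.symm)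
      (hT.trans hTcard.symm)
  · rintro rfl
    refine ⟨fun he => ?_, fun ⟨e⟩ => card_edgeSet_of_iso e (isCliqueJoin_Snp n p) hUcard
      (Finset.disjoint_empty_right _) rfl hc⟩
    obtain ⟨U, T, hU, hT, hUT, hjoin⟩ := key.2 he
    exact hjoin.nonempty_iso (isCliqueJoin_Snp n p) rfl hUT (Finset.disjoint_empty_right _)
      (hU.trans hUcard.symm) hT
end
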